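/- arXiv:1506.07350 — 2 statements merged into one kernel-verified Lean document; each statement's English description precedes it below -/
import Mathlib

section
/- Let N ≥ 13. For all F : ℝ×𝕋 → ℂ one has the hierarchy of norms: ‖F‖_{Y^{1/2}} ≲ ‖F‖_Z, and for every s > 1, ‖F‖_Z ≲_s ‖F‖_{Y^s}; moreover ‖F‖_{H^{1/2}(ℝ×𝕋)} ≲ ‖F‖_Z ≲ ‖F‖_S ≲ ‖F‖_{S⁺} (with implicit constants independent of F). -/
open scoped ENNReal NNReal BigOperators
open MeasureTheory Filter

noncomputable section

/-- A function on the cylinder `ℝ × 𝕋` represented through the family of its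
Fourier coefficients in the periodic variable `y`: `F p : ℝ → ℂ` is `x ↦ F_p(x)`. -/
abbrev FunRT : Type := ℤ → ℝ → ℂ

/-- Fourier transform in `x` (convention `ĝ(ξ) = ∫ e^{-ixξ} g(x) dx`). -/
def ftx (f : ℝ → ℂ) (ξ : ℝ) : ℂ := ∫ x : ℝ, Complex.exp (-(Complex.I * x * ξ)) * f x

/-- Inverse Fourier transform in `x`. -/
def iftx (g : ℝ → ℂ) (x : ℝ) : ℂ :=
  ((2 * Real.pi : ℝ) : ℂ)⁻¹ * ∫ ξ : ℝ, Complex.exp (Complex.I * x * ξ) * g ξ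

/-- The free Schrödinger propagator `e^{it∂_xx}` on `ℝ`, as the Fourier
multiplier `e^{-itξ²}`. -/
def schro (t : ℝ) (f : ℝ → ℂ) : ℝ → ℂ :=
  iftx fun ξ => Complex.exp (-(Complex.I * t * ξ ^ 2)) * ftx f ξ

/-- `e^{itA}` with `A = ∂_xx − |D_y|`. -/
def expA (t : ℝ) (F : FunRT) : FunRT :=
  fun p x => Complex.exp (-(Complex.I * t * |(p : ℝ)|)) * schro t (F p) x

/-- Pointwise product of functions on `ℝ × 𝕋` (convolution of the
`y`-Fourier coefficients). -/
def mulF (F G : FunRT) : FunRT := fun p x => ∑' q : ℤ, F q x * G (p - q) x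

/-- Complex conjugate of a function on `ℝ × 𝕋`. -/
def conjF (F : FunRT) : FunRT := fun p x => (starRingEnd ℂ) (F (-p) x)

def subF (F G : FunRT) : FunRT := fun p x => F p x - G p x

def smulF (c : ℂ) (F : FunRT) : FunRT := fun p x => c * F p x

/-- Multiplication by the weight `x`. -/
def xMul (F : FunRT) : FunRT := fun p x => (x : ℂ) * F p x

/-- `(1 − ∂_xx)⁴` as a Fourier multiplier in `x`. -/
def opL (F : FunRT) : FunRT :=
  fun p => iftx fun ξ => ((1 + ξ ^ 2 : ℝ) : ℂ) ^ 4 * ftx (F p) ξ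

/-- The nonlinearity `N^t[F,G,H] = e^{-itA}(e^{itA}F ⬝ conj(e^{itA}G) ⬝ e^{itA}H)`. -/
def Nt (t : ℝ) (F G H : FunRT) : FunRT :=
  expA (-t) (mulF (mulF (expA t F) (conjF (expA t G))) (expA t H))

/-- Squared `L²(ℝ×𝕋)` norm. -/
def L2sq (F : FunRT) : ℝ≥0∞ := ∑' p : ℤ, ∫⁻ x : ℝ, (‖F p x‖₊ : ℝ≥0∞) ^ 2

/-- `L²(ℝ×𝕋)` norm. -/
def L2norm (F : FunRT) : ℝ≥0∞ := L2sq F ^ (1 / 2 : ℝ)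

/-- Sobolev `H^s(ℝ×𝕋)` norm. -/
def HsNorm (s : ℝ) (F : FunRT) : ℝ≥0∞ :=
  (∑' p : ℤ, ∫⁻ ξ : ℝ,
      ENNReal.ofReal ((1 + ξ ^ 2 + (p : ℝ) ^ 2) ^ s) * (‖ftx (F p) ξ‖₊ : ℝ≥0∞) ^ 2) ^ (1 / 2 : ℝ)

/-- The norm `‖F‖_S = ‖F‖_{H^N} + ‖xF‖_{L²}`. -/
def Snorm (N : ℕ) (F : FunRT) : ℝ≥0∞ := HsNorm N F + L2norm (xMul F)

/-- The norm `‖F‖_{S⁺} = ‖F‖_S + ‖(1−∂_xx)⁴F‖_S + ‖xF‖_S`. -/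
def SplusNorm (N : ℕ) (F : FunRT) : ℝ≥0∞ :=
  Snorm N F + Snorm N (opL F) + Snorm N (xMul F)

/-- The norm `‖F‖_{Y^s} = sup_ξ (1+|ξ|²) (Σ_p (1+|p|²)^s |F̂_p(ξ)|²)^{1/2}`. -/
def Ynorm (s : ℝ) (F : FunRT) : ℝ≥0∞ :=
  ⨆ ξ : ℝ, ENNReal.ofReal (1 + ξ ^ 2) *
    (∑' p : ℤ, ENNReal.ofReal ((1 + (p : ℝ) ^ 2) ^ s) * (‖ftx (F p) ξ‖₊ : ℝ≥0∞) ^ 2) ^ (1 / 2 : ℝ)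

/-- A smooth even cutoff `φ`, identically `1` on `[-1,1]` and vanishing outside `[-2,2]`. -/
structure IsCutoff (φ : ℝ → ℝ) : Prop where
  smooth : ContDiff ℝ (⊤ : ℕ∞) φ
  compact_support : HasCompactSupport φ
  eq_one : ∀ x : ℝ, |x| ≤ 1 → φ x = 1
  eq_zero : ∀ x : ℝ, 2 ≤ |x| → φ x = 0

/-- A function on `𝕋` from its Fourier coefficients. -/
def trigSum (c : ℤ → ℂ) (y : ℝ) : ℂ := ∑' p : ℤ, c p * Complex.exp (Complex.I * p * y)

/-- `L¹(𝕋)` norm of the function with Fourier coefficients `c`. -/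
def L1T (c : ℤ → ℂ) : ℝ≥0∞ := ∫⁻ y in Set.Ioc (0 : ℝ) (2 * Real.pi), (‖trigSum c y‖₊ : ℝ≥0∞)

/-- The Besov `B¹_{1,1}(𝕋)` norm `‖S₀f‖_{L¹} + Σ_{M dyadic} M ‖Δ_M f‖_{L¹}`,
for the function `f` with Fourier coefficients `c`, built from the cutoff `φ`. -/
def B1Norm (φ : ℝ → ℝ) (c : ℤ → ℂ) : ℝ≥0∞ :=
  L1T (fun p => ((φ p : ℝ) : ℂ) * c p) +
    ∑' k : ℕ, ((2 : ℝ≥0∞) ^ (k + 1)) *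
      L1T (fun p =>
        ((φ ((p : ℝ) / 2 ^ (k + 1)) - φ (2 * (p : ℝ) / 2 ^ (k + 1)) : ℝ) : ℂ) * c p)

/-- The norm `‖F‖_Z = sup_ξ (1+|ξ|²) ‖F̂(ξ,·)‖_{B¹}`. -/
def Znorm (φ : ℝ → ℝ) (F : FunRT) : ℝ≥0∞ :=
  ⨆ ξ : ℝ, ENNReal.ofReal (1 + ξ ^ 2) * B1Norm φ fun p => ftx (F p) ξ

/-- `H^s(𝕋)` norm of the function with Fourier coefficients `c`. -/
def HsTnorm (s : ℝ) (c : ℤ → ℂ) : ℝ≥0∞ :=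
  (∑' p : ℤ, ENNReal.ofReal ((1 + (p : ℝ) ^ 2) ^ s) * (‖c p‖₊ : ℝ≥0∞) ^ 2) ^ (1 / 2 : ℝ)

/-- The norm `‖F‖_{L²_x H^s_y}`. -/
def L2HsNorm (s : ℝ) (F : FunRT) : ℝ≥0∞ :=
  (∑' p : ℤ, ENNReal.ofReal ((1 + (p : ℝ) ^ 2) ^ s) *
    ∫⁻ x : ℝ, (‖F p x‖₊ : ℝ≥0∞) ^ 2) ^ (1 / 2 : ℝ)

/-- Fourier transform in `x` of the resonant trilinear operator:
`Σ_{(p,q,r,s)∈Γ₀} F̂_q(ξ) conj(Ĝ_r(ξ)) Ĥ_s(ξ)` where `s = p − q + r`. -/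
def RopF (F G H : FunRT) (p : ℤ) (ξ : ℝ) : ℂ :=
  ∑' qr : ℤ × ℤ,
    if |p| - |qr.1| + |qr.2| - |p - qr.1 + qr.2| = 0 then
      ftx (F qr.1) ξ * (starRingEnd ℂ) (ftx (G qr.2) ξ) * ftx (H (p - qr.1 + qr.2)) ξ
    else 0

/-- The resonant trilinear operator `R`. -/
def Rop (F G H : FunRT) : FunRT := fun p => iftx (RopF F G H p)

/-- `I^t[f,g,h] = e^{-it∂_xx}(e^{it∂_xx}f ⬝ conj(e^{it∂_xx}g) ⬝ e^{it∂_xx}h)` on `ℝ`. -/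
def It (t : ℝ) (f g h : ℝ → ℂ) : ℝ → ℂ :=
  schro (-t) fun x => schro t f x * (starRingEnd ℂ) (schro t g x) * schro t h x

/-- The resonant-in-`y` part `N₀^t` of the nonlinearity. -/
def N0t (t : ℝ) (F G H : FunRT) : FunRT :=
  fun p x => ∑' qr : ℤ × ℤ,
    if |p| - |qr.1| + |qr.2| - |p - qr.1 + qr.2| = 0 then
      It t (F qr.1) (G qr.2) (H (p - qr.1 + qr.2)) x
    else 0

/-- `Ñ^t = N^t − N₀^t`. -/
def Ntil (t : ℝ) (F G H : FunRT) : FunRT := subF (Nt t F G H) (N0t t F G H)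

/-- The operator `A = ∂_xx − |D_y|`. -/
def Aop (F : FunRT) : FunRT :=
  fun p x => deriv (deriv (F p)) x - ((|(p : ℝ)| : ℝ) : ℂ) * F p x

/-- The cubic nonlinearity `|U|²U`. -/
def cubic (F : FunRT) : FunRT := mulF (mulF F (conjF F)) F

/-- `U` solves the wave guide Schrödinger equation `i∂_tU + AU = |U|²U` at time `t`. -/
def SolvesWS (U : ℝ → FunRT) (t : ℝ) : Prop :=
  ∀ p x, HasDerivAt (fun τ => U τ p x)
    (Complex.I * Aop (U t) p x - Complex.I * cubic (U t) p x) t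

/-- `G` solves the resonant system `i∂_tG = R[G,G,G]`. -/
def SolvesRS (G : ℝ → FunRT) : Prop :=
  ∀ t p x, HasDerivAt (fun τ => G τ p x) (-Complex.I * Rop (G t) (G t) (G t) p x) t

/-- The value of `F` at the point `(x,y)` of the cylinder. -/
def valF (F : FunRT) (x y : ℝ) : ℂ := ∑' p : ℤ, F p x * Complex.exp (Complex.I * p * y)

/-- `F(x, y+π) = −F(x,y)`. -/
def AntiPer (F : FunRT) : Prop := ∀ x y : ℝ, valF F x (y + Real.pi) = -valF F x y

/-- Pointwise time derivative of a time-dependent function. -/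
def dtF (F : ℝ → FunRT) (t : ℝ) : FunRT := fun p x => deriv (fun τ => F τ p x) t

/-- The space-time norm `X_T`. -/
def XTnorm (N : ℕ) (δ : ℝ) (φ : ℝ → ℝ) (T : ℝ) (F : ℝ → FunRT) : ℝ≥0∞ :=
  ⨆ t : Set.Icc (0 : ℝ) T,
    (Znorm φ (F t) + ENNReal.ofReal ((1 + |(t : ℝ)|) ^ (-δ)) * Snorm N (F t)
      + ENNReal.ofReal ((1 + |(t : ℝ)|) ^ (1 - 3 * δ)) * Snorm N (dtF F t))

/-- The space-time norm `X_T⁺`. -/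
def XTplusNorm (N : ℕ) (δ : ℝ) (φ : ℝ → ℝ) (T : ℝ) (F : ℝ → FunRT) : ℝ≥0∞ :=
  XTnorm N δ φ T F +
    ⨆ t : Set.Icc (0 : ℝ) T,
      (ENNReal.ofReal ((1 + |(t : ℝ)|) ^ (-(5 * δ))) * SplusNorm N (F t)
        + ENNReal.ofReal ((1 + |(t : ℝ)|) ^ (1 - 7 * δ)) * SplusNorm N (dtF F t))

/-- Littlewood–Paley projection `Q_{≤M}` in the `x` variable. -/
def Qle (φ : ℝ → ℝ) (M : ℝ) (F : FunRT) : FunRT :=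
  fun p => iftx fun ξ => ((φ (ξ / M) : ℝ) : ℂ) * ftx (F p) ξ

/-- Littlewood–Paley piece `Q_A` with `A = 2^k` (`Q_1 = Q_{≤1}`). -/
def Qdy (φ : ℝ → ℝ) (k : ℕ) (F : FunRT) : FunRT :=
  if k = 0 then Qle φ 1 F else subF (Qle φ (2 ^ k) F) (Qle φ (2 ^ (k - 1)) F)

/-- Time integral of a family of functions on the cylinder. -/
def intF (a b : ℝ) (Φ : ℝ → FunRT) : FunRT := fun p x => ∫ t in a..b, Φ t p x

/-- Projection `Π₊` on positive `y`-frequencies. -/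
def Pplus (F : FunRT) : FunRT := fun p x => if 0 < p then F p x else 0

/-- Projection `Π₋` on negative `y`-frequencies. -/
def Pminus (F : FunRT) : FunRT := fun p x => if p < 0 then F p x else 0

/-- Fourier transform in `x` of the reduced (Szegő) resonant operator `R₊`. -/
def RopPlusF (F G H : FunRT) (p : ℤ) (ξ : ℝ) : ℂ :=
  if 0 < p then
    ∑' qr : ℤ × ℤ,
      if 0 < qr.1 ∧ 0 < qr.2 ∧ 0 < p - qr.1 + qr.2 then
        ftx (F qr.1) ξ * (starRingEnd ℂ) (ftx (G qr.2) ξ) * ftx (H (p - qr.1 + qr.2)) ξ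
      else 0
  else 0

/-- The reduced (Szegő) resonant operator `R₊`. -/
def RopPlus (F G H : FunRT) : FunRT := fun p => iftx (RopPlusF F G H p)

/-- Fourier transform in `x` of the reduced resonant operator `R₋`. -/
def RopMinusF (F G H : FunRT) (p : ℤ) (ξ : ℝ) : ℂ :=
  if p < 0 then
    ∑' qr : ℤ × ℤ,
      if qr.1 < 0 ∧ qr.2 < 0 ∧ p - qr.1 + qr.2 < 0 then
        ftx (F qr.1) ξ * (starRingEnd ℂ) (ftx (G qr.2) ξ) * ftx (H (p - qr.1 + qr.2)) ξ
      else 0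
  else 0

/-- The reduced resonant operator `R₋`. -/
def RopMinus (F G H : FunRT) : FunRT := fun p => iftx (RopMinusF F G H p)


theorem nh_ftx_norm_exp (x ξ : ℝ) : ‖Complex.exp (-(Complex.I * x * ξ))‖ = 1 := by
  rw [Complex.norm_exp]; simp

theorem nh_ftx_meas_exp (ξ : ℝ) : Continuous (fun x : ℝ => Complex.exp (-(Complex.I * x * ξ))) := by
  fun_prop

theorem nh_ftx_integrable {f : ℝ → ℂ} (hf : Integrable f) (ξ : ℝ) :
    Integrable (fun x : ℝ => Complex.exp (-(Complex.I * x * ξ)) * f x) := by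
  refine hf.bdd_mul (c := 1) (nh_ftx_meas_exp ξ).aestronglyMeasurable ?_
  filter_upwards with x
  exact (nh_ftx_norm_exp x ξ).le

theorem nh_ftx_of_not_integrable {f : ℝ → ℂ} (hf : ¬ Integrable f) (ξ : ℝ) : ftx f ξ = 0 := by
  unfold ftx
  apply integral_undef
  intro h
  apply hf
  have := h.bdd_mul (c := 1) (f := fun x : ℝ => Complex.exp (Complex.I * x * ξ))
    (by fun_prop) (by filter_upwards with x; rw [Complex.norm_exp]; simp)
  refine this.congr ?_
  filter_upwards with x
  rw [← mul_assoc, ← Complex.exp_add]; simp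

theorem nh_ftx_continuous (f : ℝ → ℂ) : Continuous (ftx f) := by
  by_cases hf : Integrable f
  · unfold ftx
    refine continuous_of_dominated (bound := fun x => ‖f x‖) ?_ ?_ hf.norm ?_
    · intro ξ; exact (nh_ftx_integrable hf ξ).aestronglyMeasurable
    · intro ξ; filter_upwards with x
      rw [norm_mul, nh_ftx_norm_exp, one_mul]
    · filter_upwards with x; fun_prop
  · have : ftx f = fun _ => 0 := funext (nh_ftx_of_not_integrable hf)
    rw [this]; exact continuous_const

theorem nh_ftx_norm_le (f : ℝ → ℂ) (ξ : ℝ) : ‖ftx f ξ‖ ≤ ∫ x, ‖f x‖ := by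
  unfold ftx
  refine (norm_integral_le_integral_norm _).trans (le_of_eq ?_)
  congr 1; ext x
  rw [norm_mul, nh_ftx_norm_exp, one_mul]

/-- The Gaussian kernel. -/
theorem nh_gauss {ε : ℝ} (hε : 0 < ε) (u : ℝ) :
    ∫ ξ : ℝ, Complex.exp (-(Complex.I * u * ξ)) * Complex.exp (-(ε : ℂ) * ξ ^ 2) =
      ((Real.sqrt (Real.pi / ε) * Real.exp (-(1 / (4 * ε)) * u ^ 2) : ℝ) : ℂ) := by
  have h := fourierIntegral_gaussian (b := (ε : ℂ)) (by simpa using hε) (-(u : ℂ))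
  rw [show (∫ ξ : ℝ, Complex.exp (-(Complex.I * u * ξ)) * Complex.exp (-(ε : ℂ) * ξ ^ 2)) =
    ∫ x : ℝ, Complex.exp (Complex.I * (-(u : ℂ)) * x) * Complex.exp (-(ε : ℂ) * x ^ 2) from ?_, h]
  · push_cast
    rw [Real.sqrt_eq_rpow, Complex.ofReal_cpow (by positivity)]
    push_cast
    congr 2
    field_simp
  · congr 1; ext x; congr 2; ring

theorem nh_gauss_lint {ε : ℝ} (hε : 0 < ε) :
    ∫⁻ u : ℝ, ENNReal.ofReal (Real.sqrt (Real.pi / ε) * Real.exp (-(1 / (4 * ε)) * u ^ 2)) =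
      ENNReal.ofReal (2 * Real.pi) := by
  rw [← ofReal_integral_eq_lintegral_ofReal]
  · rw [integral_const_mul, integral_gaussian, ← Real.sqrt_mul (by positivity)]
    congr 1
    rw [Real.sqrt_eq_iff_mul_self_eq (by positivity) (by positivity)]
    field_simp; ring
  · exact (integrable_exp_neg_mul_sq (by positivity)).const_mul _
  · filter_upwards with u; positivity

theorem nh_planch_eps {f : ℝ → ℂ} (hf : Integrable f) {ε : ℝ} (hε : 0 < ε) :
    ∫⁻ ξ : ℝ, ENNReal.ofReal (Real.exp (-ε * ξ ^ 2) * ‖ftx f ξ‖ ^ 2) ≤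
      ENNReal.ofReal (2 * Real.pi) * ∫⁻ x : ℝ, ‖f x‖ₑ ^ 2 := by
  set K : ℝ → ℝ := fun u => Real.sqrt (Real.pi / ε) * Real.exp (-(1 / (4 * ε)) * u ^ 2) with hK
  have hK0 : ∀ u, 0 ≤ K u := fun u => by positivity
  have hKm : Continuous K := by fun_prop
  set Φ : ℝ → ℝ × ℝ → ℂ := fun ξ z =>
    Complex.exp (-(ε : ℂ) * ξ ^ 2) * ((Complex.exp (-(Complex.I * z.1 * ξ)) * f z.1) *
      (starRingEnd ℂ) (Complex.exp (-(Complex.I * z.2 * ξ)) * f z.2)) with hΦ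
  have hgi : Integrable (fun ξ : ℝ => Complex.exp (-(ε : ℂ) * ξ ^ 2)) :=
    integrable_cexp_neg_mul_sq (by simpa using hε)
  have hconj : Integrable (fun x => (starRingEnd ℂ) (f x)) := by
    refine hf.congr' ?_ ?_
    · exact Complex.continuous_conj.comp_aestronglyMeasurable hf.1
    · filter_upwards with x; simp
  have hff : Integrable (fun z : ℝ × ℝ => f z.1 * (starRingEnd ℂ) (f z.2)) := hf.mul_prod hconj
  have hint : Integrable (Function.uncurry Φ) ((volume : Measure ℝ).prod (volume : Measure (ℝ × ℝ))) := by
    have h1 := hgi.mul_prod hff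
    have h2 := h1.bdd_mul (c := 1) (f := fun w : ℝ × (ℝ × ℝ) =>
      Complex.exp (-(Complex.I * w.2.1 * w.1)) * (starRingEnd ℂ) (Complex.exp (-(Complex.I * w.2.2 * w.1))))
      (by
        apply Continuous.aestronglyMeasurable
        have := Complex.continuous_conj
        fun_prop) (by filter_upwards with w; simp [nh_ftx_norm_exp])
    refine h2.congr ?_
    filter_upwards with w
    simp only [Function.uncurry, hΦ, map_mul]
    ring
  have hLHS : ∀ ξ : ℝ, ∫ z : ℝ × ℝ, Φ ξ z = ((Real.exp (-ε * ξ ^ 2) * ‖ftx f ξ‖ ^ 2 : ℝ) : ℂ) := by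
    intro ξ
    simp only [hΦ]
    rw [integral_const_mul]
    have : ∫ z : ℝ × ℝ, (Complex.exp (-(Complex.I * z.1 * ξ)) * f z.1) *
      (starRingEnd ℂ) (Complex.exp (-(Complex.I * z.2 * ξ)) * f z.2) = ftx f ξ * (starRingEnd ℂ) (ftx f ξ) := by
      rw [ftx, ← integral_conj]
      exact integral_prod_mul (μ := (volume : Measure ℝ)) (ν := (volume : Measure ℝ))
        (fun x : ℝ => Complex.exp (-(Complex.I * x * ξ)) * f x)
        (fun y : ℝ => (starRingEnd ℂ) (Complex.exp (-(Complex.I * y * ξ)) * f y))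
    rw [this, Complex.mul_conj, Complex.normSq_eq_norm_sq]
    push_cast; rfl
  have hRHS : ∀ z : ℝ × ℝ, ∫ ξ : ℝ, Φ ξ z = (f z.1 * (starRingEnd ℂ) (f z.2)) * (K (z.1 - z.2) : ℂ) := by
    intro z
    rw [← nh_gauss hε, ← integral_const_mul]
    congr 1; ext ξ
    simp only [hΦ, map_mul, ← Complex.exp_conj]
    have : Complex.exp (-(Complex.I * ((z.1 - z.2 : ℝ) : ℂ) * ξ)) =
      Complex.exp (-(Complex.I * z.1 * ξ)) * Complex.exp ((starRingEnd ℂ) (-(Complex.I * z.2 * ξ))) := by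
      rw [← Complex.exp_add]; congr 1
      simp; ring
    rw [this]; ring
  have hswap : ∫ ξ : ℝ, ∫ z : ℝ × ℝ, Φ ξ z = ∫ z : ℝ × ℝ, ∫ ξ : ℝ, Φ ξ z := integral_integral_swap hint
  simp only [hLHS, hRHS] at hswap
  rw [integral_complex_ofReal] at hswap
  have hI0 : Integrable (fun ξ : ℝ => Real.exp (-ε * ξ ^ 2) * ‖ftx f ξ‖ ^ 2) := by
    have := hint.integral_prod_left
    simp only [Function.uncurry, hLHS] at this
    refine this.norm.congr ?_
    filter_upwards with ξ
    rw [Complex.norm_real, Real.norm_of_nonneg (by positivity)]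
  rw [← ofReal_integral_eq_lintegral_ofReal hI0 (by filter_upwards with ξ; positivity)]
  have e1 : ENNReal.ofReal (∫ ξ : ℝ, Real.exp (-ε * ξ ^ 2) * ‖ftx f ξ‖ ^ 2) ≤
      ∫⁻ z : ℝ × ℝ, ‖(f z.1 * (starRingEnd ℂ) (f z.2)) * (K (z.1 - z.2) : ℂ)‖ₑ := by
    refine le_trans ?_ (enorm_integral_le_lintegral_enorm _)
    rw [← hswap, ← ofReal_norm, Complex.norm_real]
    exact ENNReal.ofReal_le_ofReal (le_abs_self _)
  refine e1.trans ?_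
  have hfm := hf.1
  set k : ℝ → ℝ≥0∞ := fun u => ENNReal.ofReal (K u) with hk
  have hkm : Measurable k := hKm.measurable.ennreal_ofReal
  have hfe : AEMeasurable (fun x => ‖f x‖ₑ ^ 2) := hfm.enorm.pow_const 2
  have e2 : ∀ z : ℝ × ℝ, ‖(f z.1 * (starRingEnd ℂ) (f z.2)) * (K (z.1 - z.2) : ℂ)‖ₑ ≤
      (2 : ℝ≥0∞)⁻¹ * (‖f z.1‖ₑ ^ 2 * k (z.1 - z.2)) + 2⁻¹ * (‖f z.2‖ₑ ^ 2 * k (z.1 - z.2)) := by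
    intro z
    have h2 : (2 : ℝ≥0∞)⁻¹ = ENNReal.ofReal (2⁻¹) := by
      rw [ENNReal.ofReal_inv_of_pos (by norm_num)]; simp
    rw [h2, ← ofReal_norm, ← ofReal_norm, ← ofReal_norm, hk]
    simp only
    rw [← ENNReal.ofReal_pow (by positivity), ← ENNReal.ofReal_pow (by positivity),
      ← ENNReal.ofReal_mul (by positivity), ← ENNReal.ofReal_mul (by positivity),
      ← ENNReal.ofReal_mul (by positivity), ← ENNReal.ofReal_mul (by positivity),
      ← ENNReal.ofReal_add (mul_nonneg (by positivity) (mul_nonneg (by positivity) (hK0 _)))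
        (mul_nonneg (by positivity) (mul_nonneg (by positivity) (hK0 _)))]
    apply ENNReal.ofReal_le_ofReal
    rw [norm_mul, norm_mul, RCLike.norm_conj, Complex.norm_real, Real.norm_of_nonneg (hK0 _)]
    nlinarith [mul_nonneg (sq_nonneg (‖f z.1‖ - ‖f z.2‖)) (hK0 (z.1 - z.2))]
  have hkz : Measurable (fun z : ℝ × ℝ => k (z.1 - z.2)) := hkm.comp (measurable_fst.sub measurable_snd)
  have m1 : AEMeasurable (fun z : ℝ × ℝ => ‖f z.1‖ₑ ^ 2 * k (z.1 - z.2)) :=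
    (hfe.comp_quasiMeasurePreserving Measure.quasiMeasurePreserving_fst).mul hkz.aemeasurable
  have m2 : AEMeasurable (fun z : ℝ × ℝ => ‖f z.2‖ₑ ^ 2 * k (z.1 - z.2)) :=
    (hfe.comp_quasiMeasurePreserving Measure.quasiMeasurePreserving_snd).mul hkz.aemeasurable
  refine (lintegral_mono e2).trans ?_
  rw [lintegral_add_left' (m1.const_mul _), lintegral_const_mul'' _ m1, lintegral_const_mul'' _ m2]
  have i1 : ∫⁻ z : ℝ × ℝ, ‖f z.1‖ₑ ^ 2 * k (z.1 - z.2) =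
      ENNReal.ofReal (2 * Real.pi) * ∫⁻ x : ℝ, ‖f x‖ₑ ^ 2 := by
    rw [Measure.volume_eq_prod, lintegral_prod _ m1]
    have : ∀ x : ℝ, ∫⁻ y : ℝ, ‖f x‖ₑ ^ 2 * k (x - y) = ENNReal.ofReal (2 * Real.pi) * ‖f x‖ₑ ^ 2 := by
      intro x
      rw [lintegral_const_mul _ (show Measurable (fun y : ℝ => k (x - y)) from hkm.comp (by fun_prop)),
        lintegral_sub_left_eq_self (fun y => k y) x, hk, nh_gauss_lint hε, mul_comm]
    simp only [this]
    rw [lintegral_const_mul'' _ hfe]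
  have i2 : ∫⁻ z : ℝ × ℝ, ‖f z.2‖ₑ ^ 2 * k (z.1 - z.2) =
      ENNReal.ofReal (2 * Real.pi) * ∫⁻ x : ℝ, ‖f x‖ₑ ^ 2 := by
    rw [Measure.volume_eq_prod, lintegral_prod_symm _ m2]
    have : ∀ y : ℝ, ∫⁻ x : ℝ, ‖f y‖ₑ ^ 2 * k (x - y) = ENNReal.ofReal (2 * Real.pi) * ‖f y‖ₑ ^ 2 := by
      intro y
      rw [lintegral_const_mul _ (show Measurable (fun x : ℝ => k (x - y)) from hkm.comp (by fun_prop)),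
        lintegral_sub_right_eq_self (fun y => k y) y, hk, nh_gauss_lint hε, mul_comm]
    simp only [this]
    rw [lintegral_const_mul'' _ hfe]
  rw [i1, i2, ← add_mul, ENNReal.inv_two_add_inv_two, one_mul]

/-- Plancherel inequality for integrable functions. -/
theorem nh_planch {f : ℝ → ℂ} (hf : Integrable f) :
    ∫⁻ ξ : ℝ, ‖ftx f ξ‖ₑ ^ 2 ≤ ENNReal.ofReal (2 * Real.pi) * ∫⁻ x : ℝ, ‖f x‖ₑ ^ 2 := by
  set u : ℕ → ℝ := fun n => 1 / ((n : ℝ) + 1) with hu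
  have hlim : ∀ ξ : ℝ, Tendsto (fun n : ℕ => ENNReal.ofReal (Real.exp (-(u n) * ξ ^ 2) * ‖ftx f ξ‖ ^ 2))
      atTop (nhds (‖ftx f ξ‖ₑ ^ 2)) := by
    intro ξ
    rw [← ofReal_norm, ← ENNReal.ofReal_pow (by positivity)]
    apply ENNReal.tendsto_ofReal
    have h0 : Tendsto u atTop (nhds 0) := tendsto_one_div_add_atTop_nhds_zero_nat
    have : Continuous (fun t : ℝ => Real.exp (-t * ξ ^ 2) * ‖ftx f ξ‖ ^ 2) := by fun_prop
    have h1 := (this.tendsto 0).comp h0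
    simpa [Function.comp_def] using h1
  calc ∫⁻ ξ : ℝ, ‖ftx f ξ‖ₑ ^ 2
      = ∫⁻ ξ : ℝ, liminf (fun n : ℕ => ENNReal.ofReal (Real.exp (-(u n) * ξ ^ 2) * ‖ftx f ξ‖ ^ 2)) atTop := by
        congr 1; ext ξ; exact (hlim ξ).liminf_eq.symm
    _ ≤ liminf (fun n : ℕ => ∫⁻ ξ : ℝ, ENNReal.ofReal (Real.exp (-(u n) * ξ ^ 2) * ‖ftx f ξ‖ ^ 2)) atTop := by
        apply lintegral_liminf_le
        intro n
        have := nh_ftx_continuous f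
        fun_prop
    _ ≤ liminf (fun n : ℕ => ENNReal.ofReal (2 * Real.pi) * ∫⁻ x : ℝ, ‖f x‖ₑ ^ 2) atTop := by
        refine liminf_le_liminf (Eventually.of_forall fun n => ?_)
        exact nh_planch_eps hf (by simp only [hu]; positivity)
    _ = _ := by simp

theorem nh_diff {f : ℝ → ℂ} (hf : Integrable f) (h : ℝ) :
    ∫⁻ ξ : ℝ, ‖ftx f ξ - ftx f (ξ + h)‖ₑ ^ 2 ≤
      ENNReal.ofReal (h ^ 2) * (ENNReal.ofReal (2 * Real.pi) * ∫⁻ x : ℝ, ‖(x : ℂ) * f x‖ₑ ^ 2) := by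
  have hi := nh_ftx_integrable hf h
  have key : ∀ ξ, ftx f ξ - ftx f (ξ + h) =
      ftx (fun x => f x - Complex.exp (-(Complex.I * x * h)) * f x) ξ := by
    intro ξ
    unfold ftx
    rw [← integral_sub (nh_ftx_integrable hf _) (nh_ftx_integrable hf _)]
    congr 1; ext x
    have : Complex.exp (-(Complex.I * x * ((ξ + h : ℝ) : ℂ))) =
      Complex.exp (-(Complex.I * x * ξ)) * Complex.exp (-(Complex.I * x * h)) := by
      rw [← Complex.exp_add]; congr 1; push_cast; ring
    rw [this]; ring
  simp only [key]
  refine (nh_planch (hf.sub hi)).trans ?_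
  rw [mul_left_comm]
  gcongr
  rw [← lintegral_const_mul' _ _ ENNReal.ofReal_ne_top]
  apply lintegral_mono
  intro x
  simp only
  rw [← ofReal_norm, ← ofReal_norm, ← ENNReal.ofReal_pow (by positivity),
    ← ENNReal.ofReal_pow (by positivity), ← ENNReal.ofReal_mul (by positivity)]
  apply ENNReal.ofReal_le_ofReal
  have e : f x - Complex.exp (-(Complex.I * x * h)) * f x =
    -((Complex.exp (Complex.I * ((-(x * h) : ℝ) : ℂ)) - 1) * f x) := by
    push_cast
    rw [show Complex.I * -((x : ℂ) * h) = -(Complex.I * x * h) by ring]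
    ring
  rw [Pi.sub_apply, e, norm_neg, norm_mul, norm_mul]
  have := Real.norm_exp_I_mul_ofReal_sub_one_le (x := -(x * h))
  rw [Complex.norm_real, Real.norm_eq_abs, mul_pow, mul_pow, ← mul_assoc]
  have h2 : ‖Complex.exp (Complex.I * ((-(x * h) : ℝ) : ℂ)) - 1‖ ^ 2 ≤ h ^ 2 * |x| ^ 2 := by
    refine (pow_le_pow_left₀ (norm_nonneg _) this 2).trans (le_of_eq ?_)
    rw [Real.norm_eq_abs, sq_abs, sq_abs]; ring
  exact mul_le_mul_of_nonneg_right h2 (by positivity)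

theorem nh_pt_algebra {h a b c w w' : ℝ} (hh : 0 < h) (hw : 0 ≤ w) (hww : w ≤ w') :
    w * (a * (b + c)) ≤ h * ((h ^ 2)⁻¹ * a ^ 2 + (2⁻¹ * (w ^ 2 * b ^ 2) + 2⁻¹ * (w' ^ 2 * c ^ 2))) := by
  have h1 : w ^ 2 * c ^ 2 ≤ w' ^ 2 * c ^ 2 := by gcongr
  have e : h * ((h ^ 2)⁻¹ * a ^ 2 + (2⁻¹ * (w ^ 2 * b ^ 2) + 2⁻¹ * (w ^ 2 * c ^ 2))) - w * (a * (b + c))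
    = h / 2 * ((a / h - w * b) ^ 2 + (a / h - w * c) ^ 2) := by
    field_simp; ring
  have e2 : 0 ≤ h / 2 * ((a / h - w * b) ^ 2 + (a / h - w * c) ^ 2) := by positivity
  have e3 : h * (2⁻¹ * (w ^ 2 * c ^ 2)) ≤ h * (2⁻¹ * (w' ^ 2 * c ^ 2)) := by gcongr
  nlinarith

theorem nh_pt_h {g : ℝ → ℂ} (hg : Continuous g) {w : ℝ → ℝ} (hwc : Continuous w) {ξ : ℝ}
    (hw1 : 1 ≤ w ξ) (hwm : MonotoneOn w (Set.Ici ξ)) {B : ℝ≥0∞} {h : ℝ} (hh : 0 < h)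
    (hB : ∫⁻ η : ℝ, ‖g η - g (η + h)‖ₑ ^ 2 ≤ ENNReal.ofReal (h ^ 2) * B)
    (hA : ∫⁻ η : ℝ, ENNReal.ofReal (w η ^ 2) * ‖g η‖ₑ ^ 2 ≠ ⊤) :
    ENNReal.ofReal (w ξ) * ∫⁻ η in Set.Ioc ξ (ξ + h), ‖g η‖ₑ ^ 2 ≤
      ENNReal.ofReal h * (B + ∫⁻ η : ℝ, ENNReal.ofReal (w η ^ 2) * ‖g η‖ₑ ^ 2) := by
  set A := ∫⁻ η : ℝ, ENNReal.ofReal (w η ^ 2) * ‖g η‖ₑ ^ 2 with hAdef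
  have hwge : ∀ η ∈ Set.Ioi ξ, w ξ ≤ w η := fun η hη =>
    hwm (Set.mem_Ici.2 le_rfl) (Set.mem_Ici.2 (le_of_lt hη)) (le_of_lt hη)
  have shift : ∀ u : ℝ → ℝ≥0∞, ∫⁻ η in Set.Ioi ξ, u (η + h) = ∫⁻ η in Set.Ioi (ξ + h), u η := by
    intro u
    rw [← lintegral_indicator measurableSet_Ioi, ← lintegral_indicator measurableSet_Ioi,
      ← lintegral_add_right_eq_self ((Set.Ioi (ξ + h)).indicator u) h]
    congr 1; ext η
    simp [Set.indicator]
  have hX : ∫⁻ η in Set.Ioi (ξ + h), ‖g η‖ₑ ^ 2 ≠ ⊤ := by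
    refine ne_top_of_le_ne_top hA ?_
    refine le_trans ?_ (setLIntegral_le_lintegral (Set.Ioi (ξ + h)) _)
    refine setLIntegral_mono' measurableSet_Ioi ?_
    intro η hη
    have : 1 ≤ w η := hw1.trans (hwge η (by simp only [Set.mem_Ioi] at *; linarith))
    have h2 : (1 : ℝ≥0∞) ≤ ENNReal.ofReal (w η ^ 2) := by
      rw [← ENNReal.ofReal_one]; apply ENNReal.ofReal_le_ofReal; nlinarith
    calc ‖g η‖ₑ ^ 2 = 1 * ‖g η‖ₑ ^ 2 := (one_mul _).symm
      _ ≤ _ := by gcongr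
  set D : ℝ → ℝ := fun η => ‖g η - g (η + h)‖ * (‖g η‖ + ‖g (η + h)‖) with hD
  have hDc : Continuous D := by fun_prop
  have hsplit : ∫⁻ η in Set.Ioi ξ, ‖g η‖ₑ ^ 2 =
      (∫⁻ η in Set.Ioc ξ (ξ + h), ‖g η‖ₑ ^ 2) + ∫⁻ η in Set.Ioi (ξ + h), ‖g η‖ₑ ^ 2 := by
    rw [← Set.Ioc_union_Ioi_eq_Ioi (by linarith : ξ ≤ ξ + h)]
    exact lintegral_union measurableSet_Ioi (Set.Ioc_disjoint_Ioi le_rfl)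
  have hle : ∫⁻ η in Set.Ioi ξ, ‖g η‖ₑ ^ 2 ≤
      (∫⁻ η in Set.Ioi ξ, ENNReal.ofReal (D η)) + ∫⁻ η in Set.Ioi (ξ + h), ‖g η‖ₑ ^ 2 := by
    rw [← shift, ← lintegral_add_left (by fun_prop)]
    apply lintegral_mono
    intro η
    simp only
    rw [← ofReal_norm, ← ofReal_norm, ← ENNReal.ofReal_pow (by positivity),
      ← ENNReal.ofReal_pow (by positivity), ← ENNReal.ofReal_add (by positivity) (by positivity)]
    apply ENNReal.ofReal_le_ofReal
    have h1 : ‖g η‖ - ‖g (η + h)‖ ≤ ‖g η - g (η + h)‖ := norm_sub_norm_le _ _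
    have h2 := mul_le_mul_of_nonneg_right h1 (by positivity : 0 ≤ ‖g η‖ + ‖g (η + h)‖)
    simp only [hD]
    nlinarith
  rw [hsplit] at hle
  have hm3 : Measurable (fun η => ENNReal.ofReal (w (η + h) ^ 2) * ‖g (η + h)‖ₑ ^ 2) := by
    have c1 : Continuous (fun η => g (η + h)) := by fun_prop
    have c2 : Continuous (fun η => w (η + h) ^ 2) := by fun_prop
    exact c2.measurable.ennreal_ofReal.mul (c1.enorm.measurable.pow_const 2)
  have hle2 := (ENNReal.add_le_add_iff_right hX).1 hle
  calc ENNReal.ofReal (w ξ) * ∫⁻ η in Set.Ioc ξ (ξ + h), ‖g η‖ₑ ^ 2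
      ≤ ENNReal.ofReal (w ξ) * ∫⁻ η in Set.Ioi ξ, ENNReal.ofReal (D η) := by gcongr
    _ = ∫⁻ η in Set.Ioi ξ, ENNReal.ofReal (w ξ) * ENNReal.ofReal (D η) := by
        rw [lintegral_const_mul _ (by fun_prop)]
    _ ≤ ∫⁻ η in Set.Ioi ξ, ENNReal.ofReal h * (ENNReal.ofReal ((h ^ 2)⁻¹) * ‖g η - g (η + h)‖ₑ ^ 2 +
          (ENNReal.ofReal (2⁻¹) * (ENNReal.ofReal (w η ^ 2) * ‖g η‖ₑ ^ 2) +
           ENNReal.ofReal (2⁻¹) * (ENNReal.ofReal (w (η + h) ^ 2) * ‖g (η + h)‖ₑ ^ 2))) := by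
        refine setLIntegral_mono' measurableSet_Ioi ?_
        intro η hη
        have hη' : ξ < η := hη
        have w1 := hwge η hη
        have w2 : w η ≤ w (η + h) := hwm (Set.mem_Ici.2 hη'.le)
          (Set.mem_Ici.2 (by linarith)) (by linarith)
        rw [← ofReal_norm, ← ofReal_norm, ← ofReal_norm, ← ENNReal.ofReal_pow (by positivity),
          ← ENNReal.ofReal_pow (by positivity), ← ENNReal.ofReal_pow (by positivity),
          ← ENNReal.ofReal_mul (by positivity), ← ENNReal.ofReal_mul (by positivity),
          ← ENNReal.ofReal_mul (by positivity), ← ENNReal.ofReal_mul (by positivity),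
          ← ENNReal.ofReal_mul (by positivity), ← ENNReal.ofReal_mul (by positivity),
          ← ENNReal.ofReal_add (by positivity) (by positivity),
          ← ENNReal.ofReal_add (by positivity) (by positivity), ← ENNReal.ofReal_mul hh.le]
        apply ENNReal.ofReal_le_ofReal
        refine le_trans ?_ (nh_pt_algebra hh (by linarith : 0 ≤ w η) w2)
        exact mul_le_mul_of_nonneg_right w1 (by positivity)
    _ = ENNReal.ofReal h * (ENNReal.ofReal ((h ^ 2)⁻¹) * (∫⁻ η in Set.Ioi ξ, ‖g η - g (η + h)‖ₑ ^ 2) +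
          (ENNReal.ofReal (2⁻¹) * (∫⁻ η in Set.Ioi ξ, ENNReal.ofReal (w η ^ 2) * ‖g η‖ₑ ^ 2) +
           ENNReal.ofReal (2⁻¹) * (∫⁻ η in Set.Ioi ξ, ENNReal.ofReal (w (η + h) ^ 2) * ‖g (η + h)‖ₑ ^ 2))) := by
        rw [lintegral_const_mul _ (by fun_prop), lintegral_add_left (by fun_prop),
          lintegral_add_left (by fun_prop), lintegral_const_mul _ (by fun_prop),
          lintegral_const_mul _ (by fun_prop), lintegral_const_mul _ hm3]
    _ ≤ ENNReal.ofReal h * (ENNReal.ofReal ((h ^ 2)⁻¹) * (ENNReal.ofReal (h ^ 2) * B) +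
          (ENNReal.ofReal (2⁻¹) * A + ENNReal.ofReal (2⁻¹) * A)) := by
        gcongr
        · exact (setLIntegral_le_lintegral _ _).trans hB
        · exact setLIntegral_le_lintegral _ _
        · rw [shift (fun η => ENNReal.ofReal (w η ^ 2) * ‖g η‖ₑ ^ 2)]
          exact setLIntegral_le_lintegral _ _
    _ = ENNReal.ofReal h * (B + A) := by
        rw [← mul_assoc (ENNReal.ofReal ((h ^ 2)⁻¹)), ← ENNReal.ofReal_mul (by positivity),
          inv_mul_cancel₀ (by positivity), ENNReal.ofReal_one, one_mul, ← add_mul,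
          ← ENNReal.ofReal_add (by positivity) (by positivity)]
        norm_num

theorem nh_pt {g : ℝ → ℂ} (hg : Continuous g) {w : ℝ → ℝ} (hwc : Continuous w) {ξ : ℝ}
    (hw1 : 1 ≤ w ξ) (hwm : MonotoneOn w (Set.Ici ξ)) {B : ℝ≥0∞}
    (hB : ∀ h : ℝ, ∫⁻ η : ℝ, ‖g η - g (η + h)‖ₑ ^ 2 ≤ ENNReal.ofReal (h ^ 2) * B) :
    ENNReal.ofReal (w ξ) * ‖g ξ‖ₑ ^ 2 ≤
      B + ∫⁻ η : ℝ, ENNReal.ofReal (w η ^ 2) * ‖g η‖ₑ ^ 2 := by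
  by_cases hA : ∫⁻ η : ℝ, ENNReal.ofReal (w η ^ 2) * ‖g η‖ₑ ^ 2 = ⊤
  · rw [hA]; simp
  have key : ∀ r : ℝ, 0 ≤ r → r < ‖g ξ‖ ^ 2 → ENNReal.ofReal (w ξ) * ENNReal.ofReal r ≤
      B + ∫⁻ η : ℝ, ENNReal.ofReal (w η ^ 2) * ‖g η‖ₑ ^ 2 := by
    intro r hr0 hr
    have hc : Continuous (fun η => ‖g η‖ ^ 2) := by fun_prop
    have hev := (hc.tendsto ξ).eventually (lt_mem_nhds hr)
    obtain ⟨δ, hδ, hball⟩ := Metric.eventually_nhds_iff.1 hev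
    have hh : 0 < δ / 2 := by linarith
    have h1 := nh_pt_h hg hwc hw1 hwm hh (hB _) hA
    have h2 : ENNReal.ofReal (δ / 2) * ENNReal.ofReal r ≤
        ∫⁻ η in Set.Ioc ξ (ξ + δ / 2), ‖g η‖ₑ ^ 2 := by
      calc ENNReal.ofReal (δ / 2) * ENNReal.ofReal r
          = ∫⁻ η in Set.Ioc ξ (ξ + δ / 2), ENNReal.ofReal r := by
            rw [setLIntegral_const, Real.volume_Ioc, mul_comm]; congr 2; ring
        _ ≤ _ := by
            refine setLIntegral_mono' measurableSet_Ioc ?_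
            intro η hη
            rw [← ofReal_norm, ← ENNReal.ofReal_pow (by positivity)]
            apply ENNReal.ofReal_le_ofReal
            apply le_of_lt
            apply hball
            rw [Real.dist_eq, abs_of_nonneg (by linarith [hη.1])]
            linarith [hη.2]
    have h3 : ENNReal.ofReal (δ / 2) * (ENNReal.ofReal (w ξ) * ENNReal.ofReal r) ≤
        ENNReal.ofReal (δ / 2) * (B + ∫⁻ η : ℝ, ENNReal.ofReal (w η ^ 2) * ‖g η‖ₑ ^ 2) := by
      refine le_trans ?_ h1
      rw [mul_left_comm]
      gcongr
    exact (ENNReal.mul_le_mul_iff_right (by simpa using hh) ENNReal.ofReal_ne_top).1 h3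
  by_cases h0 : ‖g ξ‖ ^ 2 = 0
  · have : ‖g ξ‖ₑ ^ 2 = 0 := by
      rw [← ofReal_norm, ← ENNReal.ofReal_pow (by positivity), h0]; simp
    rw [this]; simp
  have hpos : 0 < ‖g ξ‖ ^ 2 := lt_of_le_of_ne (by positivity) (Ne.symm h0)
  rw [← ofReal_norm, ← ENNReal.ofReal_pow (by positivity), ← ENNReal.ofReal_mul (by linarith)]
  have hcont : Tendsto (fun r : ℝ => ENNReal.ofReal (w ξ * r)) (nhdsWithin (‖g ξ‖ ^ 2) (Set.Iio (‖g ξ‖ ^ 2)))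
      (nhds (ENNReal.ofReal (w ξ * ‖g ξ‖ ^ 2))) := by
    apply ENNReal.tendsto_ofReal
    exact ((continuous_const.mul continuous_id).tendsto _).mono_left nhdsWithin_le_nhds
  refine le_of_tendsto hcont ?_
  filter_upwards [Ioo_mem_nhdsLT hpos] with r hr
  rw [ENNReal.ofReal_mul (by linarith)]
  exact key r hr.1.le hr.2

theorem nh_ftx_neg (f : ℝ → ℂ) (ξ : ℝ) : ftx (fun x => f (-x)) ξ = ftx f (-ξ) := by
  unfold ftx
  rw [← integral_neg_eq_self]
  congr 1; ext x
  simp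

/-- The main pointwise bound for one mode. -/
theorem nh_mode (f : ℝ → ℂ) (p : ℝ) (N : ℕ) (hN : 13 ≤ N) (ξ : ℝ) :
    ENNReal.ofReal ((1 + ξ ^ 2) ^ 2 * (1 + p ^ 2) ^ 2) * ‖ftx f ξ‖ₑ ^ 2 ≤
      ENNReal.ofReal (2 * Real.pi) * (∫⁻ x : ℝ, ‖(x : ℂ) * f x‖ₑ ^ 2) +
      ∫⁻ η : ℝ, ENNReal.ofReal ((1 + η ^ 2 + p ^ 2) ^ (N : ℝ)) * ‖ftx f η‖ₑ ^ 2 := by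
  by_cases hf : Integrable f
  swap
  · rw [nh_ftx_of_not_integrable hf]; simp
  have main : ∀ (f : ℝ → ℂ), Integrable f → ∀ ξ : ℝ, 0 ≤ ξ →
    ENNReal.ofReal ((1 + ξ ^ 2) ^ 2 * (1 + p ^ 2) ^ 2) * ‖ftx f ξ‖ₑ ^ 2 ≤
      ENNReal.ofReal (2 * Real.pi) * (∫⁻ x : ℝ, ‖(x : ℂ) * f x‖ₑ ^ 2) +
      ∫⁻ η : ℝ, ENNReal.ofReal ((1 + η ^ 2 + p ^ 2) ^ (N : ℝ)) * ‖ftx f η‖ₑ ^ 2 := by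
    intro f hf ξ hξ
    have := nh_pt (nh_ftx_continuous f) (w := fun ξ => (1 + ξ ^ 2) ^ 2 * (1 + p ^ 2) ^ 2)
      (by fun_prop) (ξ := ξ) (by
        have h1 : 1 ≤ (1 + ξ ^ 2) ^ 2 := one_le_pow₀ (by nlinarith [sq_nonneg ξ])
        have h2 : 1 ≤ (1 + p ^ 2) ^ 2 := one_le_pow₀ (by nlinarith [sq_nonneg p])
        exact one_le_mul_of_one_le_of_one_le h1 h2) (by
        intro a ha b hb hab
        have : 0 ≤ a := hξ.trans ha
        simp only
        gcongr) (nh_diff hf)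
    refine this.trans ?_
    gcongr with η
    rw [Real.rpow_natCast]
    have a1 : 1 + η ^ 2 ≤ 1 + η ^ 2 + p ^ 2 := by nlinarith [sq_nonneg p]
    have a2 : 1 + p ^ 2 ≤ 1 + η ^ 2 + p ^ 2 := by nlinarith [sq_nonneg η]
    calc ((1 + η ^ 2) ^ 2 * (1 + p ^ 2) ^ 2) ^ 2
        ≤ ((1 + η ^ 2 + p ^ 2) ^ 2 * (1 + η ^ 2 + p ^ 2) ^ 2) ^ 2 := by gcongr
      _ = (1 + η ^ 2 + p ^ 2) ^ 8 := by ring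
      _ ≤ _ := pow_le_pow_right₀ (by nlinarith [sq_nonneg p, sq_nonneg η]) (by omega)
  rcases le_total 0 ξ with hξ | hξ
  · exact main f hf ξ hξ
  · have := main (fun x => f (-x)) hf.comp_neg (-ξ) (by linarith)
    simp only [nh_ftx_neg, neg_neg, neg_sq] at this
    refine this.trans (le_of_eq ?_)
    congr 1
    · congr 1
      rw [← lintegral_neg_eq_self]
      congr 1; ext x; simp
    · rw [← lintegral_neg_eq_self]
      congr 1; ext x; simp

theorem nh_orth (n : ℤ) :
    ∫ y in Set.Ioc (0 : ℝ) (2 * Real.pi), Complex.exp (Complex.I * n * y) =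
      if n = 0 then ((2 * Real.pi : ℝ) : ℂ) else 0 := by
  rw [← intervalIntegral.integral_of_le (by positivity)]
  split_ifs with hn
  · subst hn; simp
  · rw [integral_exp_mul_complex (by simp [hn])]
    have : Complex.I * n * ((2 * Real.pi : ℝ) : ℂ) = n * (2 * Real.pi * Complex.I) := by
      push_cast; ring
    rw [this, Complex.exp_int_mul_two_pi_mul_I]
    simp

theorem nh_trig_eq {c : ℤ → ℂ} {s : Finset ℤ} (hs : ∀ p ∉ s, c p = 0) (y : ℝ) :
    trigSum c y = ∑ p ∈ s, c p * Complex.exp (Complex.I * p * y) := by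
  unfold trigSum
  apply tsum_eq_sum
  intro p hp; rw [hs p hp, zero_mul]

theorem nh_trig_cont {c : ℤ → ℂ} {s : Finset ℤ} (hs : ∀ p ∉ s, c p = 0) : Continuous (trigSum c) := by
  have : trigSum c = fun y : ℝ => ∑ p ∈ s, c p * Complex.exp (Complex.I * p * y) :=
    funext (nh_trig_eq hs)
  rw [this]; fun_prop

theorem nh_coeff {c : ℤ → ℂ} {s : Finset ℤ} (hs : ∀ p ∉ s, c p = 0) (q : ℤ) :
    ∫ y in Set.Ioc (0 : ℝ) (2 * Real.pi), trigSum c y * Complex.exp (-(Complex.I * q * y)) =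
      ((2 * Real.pi : ℝ) : ℂ) * c q := by
  have h1 : ∀ y : ℝ, trigSum c y * Complex.exp (-(Complex.I * q * y)) =
      ∑ p ∈ s, c p * Complex.exp (Complex.I * ((p - q : ℤ) : ℂ) * y) := by
    intro y
    rw [nh_trig_eq hs, Finset.sum_mul]
    refine Finset.sum_congr rfl fun p _ => ?_
    rw [mul_assoc, ← Complex.exp_add]
    congr 2; push_cast; ring
  simp only [h1]
  rw [integral_finsetSum]
  · simp only [integral_const_mul, nh_orth, sub_eq_zero, mul_ite, mul_zero]
    rw [Finset.sum_ite_eq']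
    split_ifs with h
    · ring
    · rw [hs q h]; simp
  · intro p _
    have : Continuous (fun y : ℝ => c p * Complex.exp (Complex.I * ((p - q : ℤ) : ℂ) * y)) := by fun_prop
    exact (this.integrableOn_Icc).mono_set Set.Ioc_subset_Icc_self

theorem nh_coeff_le {c : ℤ → ℂ} {s : Finset ℤ} (hs : ∀ p ∉ s, c p = 0) (q : ℤ) :
    ‖c q‖ₑ ≤ L1T c := by
  have h := nh_coeff hs q
  have h2 : ‖((2 * Real.pi : ℝ) : ℂ) * c q‖ₑ ≤ L1T c := by
    rw [← h]
    refine (enorm_integral_le_lintegral_enorm _).trans ?_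
    unfold L1T
    apply lintegral_mono
    intro y
    simp only
    rw [enorm_mul, ← ofReal_norm (Complex.exp _), Complex.norm_exp]
    simp [enorm_eq_nnnorm]
  refine le_trans ?_ h2
  rw [← ofReal_norm, ← ofReal_norm]
  apply ENNReal.ofReal_le_ofReal
  rw [norm_mul, Complex.norm_real, Real.norm_of_nonneg (by positivity)]
  have : (1 : ℝ) ≤ 2 * Real.pi := by linarith [Real.pi_gt_three]
  nlinarith [norm_nonneg (c q)]

theorem nh_parseval {c : ℤ → ℂ} {s : Finset ℤ} (hs : ∀ p ∉ s, c p = 0) :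
    ∫⁻ y in Set.Ioc (0 : ℝ) (2 * Real.pi), ‖trigSum c y‖ₑ ^ 2 =
      ENNReal.ofReal (2 * Real.pi) * ∑' p, ‖c p‖ₑ ^ 2 := by
  have hc := nh_trig_cont hs
  have h1 : ∀ y : ℝ, ((‖trigSum c y‖ ^ 2 : ℝ) : ℂ) =
      ∑ q ∈ s, (starRingEnd ℂ) (c q) * (trigSum c y * Complex.exp (-(Complex.I * q * y))) := by
    intro y
    rw [← Complex.normSq_eq_norm_sq, ← Complex.mul_conj]
    conv_lhs => rw [nh_trig_eq hs y]
    rw [← nh_trig_eq hs y]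
    conv_lhs => arg 2; rw [nh_trig_eq hs y]
    rw [map_sum, Finset.mul_sum]
    refine Finset.sum_congr rfl fun q _ => ?_
    rw [map_mul, ← Complex.exp_conj]
    have : (starRingEnd ℂ) (Complex.I * q * y) = -(Complex.I * q * y) := by simp
    rw [this]; ring
  have h2 : ∫ y in Set.Ioc (0 : ℝ) (2 * Real.pi), ((‖trigSum c y‖ ^ 2 : ℝ) : ℂ) =
      ((2 * Real.pi * ∑ q ∈ s, ‖c q‖ ^ 2 : ℝ) : ℂ) := by
    simp only [h1]
    rw [integral_finsetSum]
    · simp only [integral_const_mul, nh_coeff hs]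
      rw [Complex.ofReal_mul (2 * Real.pi), Complex.ofReal_sum, Finset.mul_sum]
      refine Finset.sum_congr rfl fun q _ => ?_
      rw [← Complex.normSq_eq_norm_sq, ← Complex.mul_conj]; ring
    · intro q _
      have : Continuous (fun y : ℝ => (starRingEnd ℂ) (c q) *
        (trigSum c y * Complex.exp (-(Complex.I * q * y)))) := by fun_prop
      exact (this.integrableOn_Icc).mono_set Set.Ioc_subset_Icc_self
  rw [integral_complex_ofReal] at h2
  have h3 := Complex.ofReal_injective h2
  have hcs : Continuous (fun y => ‖trigSum c y‖ ^ 2) := by fun_prop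
  have h4 : ∫⁻ y in Set.Ioc (0 : ℝ) (2 * Real.pi), ‖trigSum c y‖ₑ ^ 2 =
      ENNReal.ofReal (∫ y in Set.Ioc (0 : ℝ) (2 * Real.pi), ‖trigSum c y‖ ^ 2) := by
    rw [ofReal_integral_eq_lintegral_ofReal
      ((hcs.integrableOn_Icc).mono_set Set.Ioc_subset_Icc_self) (by filter_upwards with y; positivity)]
    congr 1; ext y
    rw [← ofReal_norm, ENNReal.ofReal_pow (by positivity)]
  rw [h4, h3, ENNReal.ofReal_mul (by positivity), ENNReal.ofReal_sum_of_nonneg (fun _ _ => by positivity)]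
  rw [tsum_eq_sum (s := s) (fun p hp => by rw [hs p hp]; simp)]
  congr 1
  refine Finset.sum_congr rfl fun q _ => ?_
  rw [← ofReal_norm, ENNReal.ofReal_pow (by positivity)]

theorem nh_L1_le {c : ℤ → ℂ} {s : Finset ℤ} (hs : ∀ p ∉ s, c p = 0) :
    L1T c ^ 2 ≤ ENNReal.ofReal (2 * Real.pi) ^ 2 * ∑' p, ‖c p‖ₑ ^ 2 := by
  have hc := nh_trig_cont hs
  set μ := (volume : Measure ℝ).restrict (Set.Ioc (0 : ℝ) (2 * Real.pi)) with hμ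
  have h := ENNReal.lintegral_mul_le_Lp_mul_Lq μ (Real.HolderConjugate.two_two)
    (f := fun y => ‖trigSum c y‖ₑ) (g := fun _ => 1) (by fun_prop) (by fun_prop)
  have e1 : L1T c = ∫⁻ y, ((fun y : ℝ => ‖trigSum c y‖ₑ) * (fun _ : ℝ => (1 : ℝ≥0∞)) : ℝ → ℝ≥0∞) y ∂μ := by
    unfold L1T; simp [enorm_eq_nnnorm, hμ]
  rw [← e1] at h
  have h2 : L1T c ^ 2 ≤ ((∫⁻ y, ‖trigSum c y‖ₑ ^ (2 : ℝ) ∂μ) ^ (1 / 2 : ℝ) *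
    (∫⁻ _, (1 : ℝ≥0∞) ^ (2 : ℝ) ∂μ) ^ (1 / 2 : ℝ)) ^ 2 := by gcongr
  refine h2.trans (le_of_eq ?_)
  rw [mul_pow, ← ENNReal.rpow_natCast, ← ENNReal.rpow_mul, ← ENNReal.rpow_natCast, ← ENNReal.rpow_mul]
  norm_num
  have := nh_parseval hs
  rw [← hμ] at this
  rw [this, hμ]
  simp
  ring

/-- Littlewood–Paley blocks, indexed uniformly. -/
def nhBlk (φ : ℝ → ℝ) (c : ℤ → ℂ) : ℕ → ℤ → ℂ
  | 0 => fun p => ((φ p : ℝ) : ℂ) * c p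
  | (k + 1) => fun p => ((φ ((p : ℝ) / 2 ^ (k + 1)) - φ (2 * (p : ℝ) / 2 ^ (k + 1)) : ℝ) : ℂ) * c p

theorem nh_B1_eq (φ : ℝ → ℝ) (c : ℤ → ℂ) :
    B1Norm φ c = ∑' m : ℕ, (2 : ℝ≥0∞) ^ m * L1T (nhBlk φ c m) := by
  rw [tsum_eq_zero_add' ENNReal.summable]
  simp [B1Norm, nhBlk]

theorem nh_blk_supp {φ : ℝ → ℝ} (hφ : IsCutoff φ) (c : ℤ → ℂ) (m : ℕ) (p : ℤ)
    (hp : (2 : ℤ) ^ (m + 1) ≤ |p|) : nhBlk φ c m p = 0 := by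
  have hp' : (2 : ℝ) ^ (m + 1) ≤ |(p : ℝ)| := by exact_mod_cast hp
  cases m with
  | zero =>
    simp only [nhBlk]
    rw [hφ.eq_zero _ (by simpa using hp')]; simp
  | succ k =>
    simp only [nhBlk]
    have h0 : (0 : ℝ) < 2 ^ (k + 1) := by positivity
    rw [hφ.eq_zero, hφ.eq_zero]
    · simp
    · rw [abs_div, abs_mul, abs_of_pos h0, le_div_iff₀ h0]
      simp only [abs_two]
      rw [pow_succ] at hp'
      nlinarith
    · rw [abs_div, abs_of_pos h0, le_div_iff₀ h0]
      rw [pow_succ] at hp'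
      linarith

theorem nh_blk_low {φ : ℝ → ℝ} (hφ : IsCutoff φ) (c : ℤ → ℂ) (m : ℕ) (p : ℤ)
    (hp : nhBlk φ c m p ≠ 0) : (4 : ℝ) ^ m ≤ 4 * (1 + (p : ℝ) ^ 2) := by
  cases m with
  | zero => nlinarith [sq_nonneg (p : ℝ)]
  | succ k =>
    by_contra! hlt
    apply hp
    simp only [nhBlk]
    have h0 : (0 : ℝ) < 2 ^ (k + 1) := by positivity
    have h4 : (4 : ℝ) ^ (k + 1) = 4 * (2 ^ k) ^ 2 := by
      rw [pow_succ, ← pow_mul, mul_comm k 2, pow_mul]; norm_num; ring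
    have hlt2 : (p : ℝ) ^ 2 ≤ (2 ^ k) ^ 2 := by rw [h4] at hlt; linarith
    have habs : |(p : ℝ)| ≤ 2 ^ k := abs_le_of_sq_le_sq hlt2 (by positivity)
    rw [hφ.eq_one, hφ.eq_one]
    · simp
    · rw [abs_div, abs_mul, abs_of_pos h0, div_le_one h0, abs_two, pow_succ]
      linarith
    · rw [abs_div, abs_of_pos h0, div_le_one h0, pow_succ]
      linarith [abs_nonneg (p : ℝ)]

theorem nh_blk_finsupp {φ : ℝ → ℝ} (hφ : IsCutoff φ) (c : ℤ → ℂ) (m : ℕ) :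
    ∀ p ∉ Finset.Icc (-(2 : ℤ) ^ (m + 1)) ((2 : ℤ) ^ (m + 1)), nhBlk φ c m p = 0 := by
  intro p hp
  apply nh_blk_supp hφ
  by_contra! h
  apply hp
  rw [Finset.mem_Icc]
  exact abs_le.1 h.le

theorem nh_blk_sum {φ : ℝ → ℝ} (c : ℤ → ℂ) (p : ℤ) (K : ℕ) :
    ∑ m ∈ Finset.range (K + 1), nhBlk φ c m p = ((φ ((p : ℝ) / 2 ^ K) : ℝ) : ℂ) * c p := by
  induction K with
  | zero => simp [nhBlk]
  | succ K ih =>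
    rw [Finset.sum_range_succ, ih]
    simp only [nhBlk]
    have : 2 * (p : ℝ) / 2 ^ (K + 1) = p / 2 ^ K := by
      rw [pow_succ]; field_simp
    rw [this]; push_cast; ring

theorem nh_blk_le {φ : ℝ → ℝ} (hφ : IsCutoff φ) (c : ℤ → ℂ) (p : ℤ) :
    ‖c p‖ₑ ≤ ∑' m, ‖nhBlk φ c m p‖ₑ := by
  obtain ⟨K, hK⟩ := pow_unbounded_of_one_lt |(p : ℝ)| (one_lt_two)
  have h := nh_blk_sum (φ := φ) c p K
  rw [hφ.eq_one] at h
  · simp only [Complex.ofReal_one, one_mul] at h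
    rw [← h]
    exact (enorm_sum_le _ _).trans (ENNReal.sum_le_tsum _)
  · rw [abs_div, abs_of_pos (by positivity : (0 : ℝ) < 2 ^ K), div_le_one (by positivity)]
    exact hK.le

/-- counting bound -/
theorem nh_count (m n : ℕ) :
    ∑' p : ℤ, ENNReal.ofReal ((1 + (p : ℝ) ^ 2) ^ (1 / 2 : ℝ)) *
      ((if |p| < (2 : ℤ) ^ (m + 1) then 1 else 0) * (if |p| < (2 : ℤ) ^ (n + 1) then 1 else 0)) ≤
      15 * (2 ^ m * 2 ^ n) := by
  wlog hmn : m ≤ n generalizing m n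
  · have := this n m (by omega)
    rw [mul_comm (2 ^ n : ℝ≥0∞)] at this
    refine le_trans (le_of_eq ?_) this
    congr 1; ext p; rw [mul_comm (if |p| < (2 : ℤ) ^ (m + 1) then (1 : ℝ≥0∞) else 0)]
  set s := Finset.Icc (-(2 : ℤ) ^ (m + 1)) ((2 : ℤ) ^ (m + 1)) with hs
  calc _ ≤ ∑' p : ℤ, (if p ∈ s then (3 * 2 ^ m : ℝ≥0∞) else 0) := by
        apply ENNReal.tsum_le_tsum
        intro p
        by_cases hp : |p| < (2 : ℤ) ^ (m + 1)
        · have hmem : p ∈ s := by rw [hs, Finset.mem_Icc]; exact abs_le.1 hp.le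
          rw [if_pos hmem, if_pos hp, one_mul]
          have hp' : |(p : ℝ)| < 2 ^ (m + 1) := by exact_mod_cast hp
          have h1 : (1 + (p : ℝ) ^ 2) ^ (1 / 2 : ℝ) ≤ 3 * 2 ^ m := by
            rw [← Real.sqrt_eq_rpow]
            apply Real.sqrt_le_iff.2
            refine ⟨by positivity, ?_⟩
            have hone : (1 : ℝ) ≤ 2 ^ m := one_le_pow₀ (by norm_num)
            rw [← sq_abs (p : ℝ)]
            rw [pow_succ] at hp'
            nlinarith [abs_nonneg (p : ℝ)]
          calc _ ≤ ENNReal.ofReal (3 * 2 ^ m) * 1 := by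
                gcongr
                split_ifs <;> simp
            _ = _ := by
                rw [mul_one, ENNReal.ofReal_mul (by norm_num), ENNReal.ofReal_pow (by norm_num)]; simp
        · simp [hp]
    _ = ∑ p ∈ s, (3 * 2 ^ m : ℝ≥0∞) := by
        rw [tsum_eq_sum (s := s) (fun p hp => by simp [hp])]
        exact Finset.sum_congr rfl fun p hp => by rw [if_pos hp]
    _ = (s.card : ℝ≥0∞) * (3 * 2 ^ m) := by rw [Finset.sum_const, nsmul_eq_mul]
    _ ≤ (5 * 2 ^ m) * (3 * 2 ^ m) := by
        gcongr
        have : s.card ≤ 5 * 2 ^ m := by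
          rw [hs, Int.card_Icc]
          have : (1 : ℤ) ≤ 2 ^ m := one_le_pow₀ (by norm_num)
          have e : (2 : ℤ) ^ (m + 1) = 2 * 2 ^ m := by ring
          rw [e]
          zify
          rw [Int.toNat_of_nonneg (by linarith)]
          linarith
        exact_mod_cast this
    _ = 15 * (2 ^ m * 2 ^ m) := by ring
    _ ≤ _ := by
        gcongr
        norm_num

theorem nh_besov_lower {φ : ℝ → ℝ} (hφ : IsCutoff φ) (c : ℤ → ℂ) :
    ∑' p : ℤ, ENNReal.ofReal ((1 + (p : ℝ) ^ 2) ^ (1 / 2 : ℝ)) * ‖c p‖ₑ ^ 2 ≤ 15 * B1Norm φ c ^ 2 := by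
  set L : ℕ → ℝ≥0∞ := fun m => L1T (nhBlk φ c m) with hL
  set I : ℕ → ℤ → ℝ≥0∞ := fun m p => if |p| < (2 : ℤ) ^ (m + 1) then 1 else 0 with hI
  set W : ℤ → ℝ≥0∞ := fun p => ENNReal.ofReal ((1 + (p : ℝ) ^ 2) ^ (1 / 2 : ℝ)) with hW
  have h1 : ∀ p, ‖c p‖ₑ ≤ ∑' m, I m p * L m := by
    intro p
    refine (nh_blk_le hφ c p).trans (ENNReal.tsum_le_tsum fun m => ?_)
    by_cases hp : |p| < (2 : ℤ) ^ (m + 1)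
    · simp only [hI, if_pos hp, one_mul]
      exact nh_coeff_le (nh_blk_finsupp hφ c m) p
    · rw [nh_blk_supp hφ c m p (not_lt.1 hp)]; simp
  have h2 : ∀ p, W p * ‖c p‖ₑ ^ 2 ≤ ∑' m, ∑' n, (W p * (I m p * I n p)) * (L m * L n) := by
    intro p
    calc W p * ‖c p‖ₑ ^ 2 ≤ W p * ((∑' m, I m p * L m) * ∑' n, I n p * L n) := by
          rw [sq]; gcongr <;> exact h1 p
      _ = ∑' m, ∑' n, (W p * (I m p * I n p)) * (L m * L n) := by
          rw [← ENNReal.tsum_mul_right, ← ENNReal.tsum_mul_left]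
          congr 1; ext m
          rw [← ENNReal.tsum_mul_left, ← ENNReal.tsum_mul_left]
          congr 1; ext n
          ring
  calc ∑' p, W p * ‖c p‖ₑ ^ 2 ≤ ∑' p, ∑' m, ∑' n, (W p * (I m p * I n p)) * (L m * L n) :=
        ENNReal.tsum_le_tsum h2
    _ = ∑' m, ∑' n, (∑' p, W p * (I m p * I n p)) * (L m * L n) := by
        rw [ENNReal.tsum_comm]
        congr 1; ext m
        rw [ENNReal.tsum_comm]
        congr 1; ext n
        rw [ENNReal.tsum_mul_right]
    _ ≤ ∑' m, ∑' n, (15 * (2 ^ m * 2 ^ n)) * (L m * L n) := by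
        refine ENNReal.tsum_le_tsum fun m => ENNReal.tsum_le_tsum fun n => ?_
        gcongr
        exact nh_count m n
    _ = 15 * B1Norm φ c ^ 2 := by
        rw [nh_B1_eq, sq, ← ENNReal.tsum_mul_right, ← ENNReal.tsum_mul_left]
        congr 1; ext m
        rw [← ENNReal.tsum_mul_left, ← ENNReal.tsum_mul_left]
        congr 1; ext n
        ring

theorem nh_sqrt_sq (a : ℝ≥0∞) : (a ^ (1 / 2 : ℝ)) ^ 2 = a := by
  rw [← ENNReal.rpow_natCast, ← ENNReal.rpow_mul]; norm_num

theorem nh_sq_sqrt (a : ℝ≥0∞) : (a ^ 2) ^ (1 / 2 : ℝ) = a := by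
  rw [← ENNReal.rpow_natCast, ← ENNReal.rpow_mul]; norm_num

theorem nh_le_of_sq {a b : ℝ≥0∞} (h : a ^ 2 ≤ b ^ 2) : a ≤ b := by
  rw [← nh_sq_sqrt a, ← nh_sq_sqrt b]
  exact ENNReal.rpow_le_rpow h (by norm_num)

theorem nh_besov_upper {φ : ℝ → ℝ} (hφ : IsCutoff φ) {s : ℝ} (hs : 1 < s) :
    ∃ C : ℝ, 0 < C ∧ ∀ c : ℤ → ℂ, B1Norm φ c ≤ ENNReal.ofReal C *
      (∑' p : ℤ, ENNReal.ofReal ((1 + (p : ℝ) ^ 2) ^ s) * ‖c p‖ₑ ^ 2) ^ (1 / 2 : ℝ) := by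
  obtain ⟨K, hK⟩ := hφ.smooth.continuous.bounded_above_of_compact_support hφ.compact_support
  have hK1 : 1 ≤ K := by
    have := hK 0
    rw [hφ.eq_one 0 (by simp)] at this; simpa using this
  have hblk : ∀ c : ℤ → ℂ, ∀ m p, ‖nhBlk φ c m p‖ ≤ (2 * K) * ‖c p‖ := by
    intro c m p
    cases m with
    | zero =>
      simp only [nhBlk]
      rw [norm_mul, Complex.norm_real]
      gcongr
      exact (hK _).trans (by linarith)
    | succ k =>
      simp only [nhBlk]
      rw [norm_mul, Complex.norm_real]
      gcongr
      refine (norm_sub_le _ _).trans ?_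
      linarith [hK ((p : ℝ) / 2 ^ (k + 1)), hK (2 * (p : ℝ) / 2 ^ (k + 1))]
  set q : ℝ := 2 ^ (1 - s) with hq
  have hq0 : 0 < q := by positivity
  have hq1 : q < 1 := Real.rpow_lt_one_of_one_lt_of_neg (by norm_num) (by linarith)
  set D : ℝ := 2 * Real.pi * (2 * K) * 2 ^ s with hD
  have hD0 : 0 < D := by positivity
  refine ⟨D * (1 - q)⁻¹, mul_pos hD0 (inv_pos.2 (by linarith)), ?_⟩
  intro c
  set H : ℝ≥0∞ := ∑' p : ℤ, ENNReal.ofReal ((1 + (p : ℝ) ^ 2) ^ s) * ‖c p‖ₑ ^ 2 with hH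
  have hterm : ∀ m : ℕ, (2 : ℝ≥0∞) ^ m * L1T (nhBlk φ c m) ≤ ENNReal.ofReal D * H ^ (1 / 2 : ℝ) *
      ENNReal.ofReal q ^ m := by
    intro m
    apply nh_le_of_sq
    have e1 : ∑' p, ‖nhBlk φ c m p‖ₑ ^ 2 ≤
        ENNReal.ofReal ((2 * K) ^ 2 * (4 ^ s * ((4 : ℝ) ^ m) ^ (-s))) * H := by
      rw [hH, ← ENNReal.tsum_mul_left]
      refine ENNReal.tsum_le_tsum fun p => ?_
      by_cases h0 : nhBlk φ c m p = 0
      · rw [h0]; simp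
      have hl := nh_blk_low hφ c m p h0
      rw [← ofReal_norm, ← ofReal_norm, ← ENNReal.ofReal_pow (by positivity),
        ← ENNReal.ofReal_pow (by positivity), ← ENNReal.ofReal_mul (by positivity),
        ← ENNReal.ofReal_mul (by positivity)]
      apply ENNReal.ofReal_le_ofReal
      have h1 : 1 ≤ 4 ^ s * ((4 : ℝ) ^ m) ^ (-s) * (1 + (p : ℝ) ^ 2) ^ s := by
        rw [Real.rpow_neg (by positivity), mul_right_comm, ← div_eq_mul_inv,
          one_le_div (by positivity), ← Real.mul_rpow (by norm_num) (by positivity)]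
        exact Real.rpow_le_rpow (by positivity) hl (by linarith)
      have h2 : ‖nhBlk φ c m p‖ ^ 2 ≤ (2 * K) ^ 2 * ‖c p‖ ^ 2 := by
        rw [← mul_pow]
        exact pow_le_pow_left₀ (norm_nonneg _) (hblk c m p) 2
      calc _ ≤ (2 * K) ^ 2 * ‖c p‖ ^ 2 * 1 := by rw [mul_one]; exact h2
        _ ≤ (2 * K) ^ 2 * ‖c p‖ ^ 2 * (4 ^ s * ((4 : ℝ) ^ m) ^ (-s) * (1 + (p : ℝ) ^ 2) ^ s) := by gcongr
        _ = _ := by ring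
    have e2 := nh_L1_le (nh_blk_finsupp hφ c m)
    rw [mul_pow, mul_pow, mul_pow, nh_sqrt_sq]
    calc ((2 : ℝ≥0∞) ^ m) ^ 2 * L1T (nhBlk φ c m) ^ 2
        ≤ ((2 : ℝ≥0∞) ^ m) ^ 2 * (ENNReal.ofReal (2 * Real.pi) ^ 2 *
          (ENNReal.ofReal ((2 * K) ^ 2 * (4 ^ s * ((4 : ℝ) ^ m) ^ (-s))) * H)) := by
          gcongr
          exact e2.trans (by gcongr)
      _ = ENNReal.ofReal ((2 ^ m) ^ 2 * ((2 * Real.pi) ^ 2 * ((2 * K) ^ 2 * (4 ^ s * ((4 : ℝ) ^ m) ^ (-s))))) * H := by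
          rw [show (2 : ℝ≥0∞) = ENNReal.ofReal 2 by simp]
          rw [← ENNReal.ofReal_pow (by norm_num), ← ENNReal.ofReal_pow (by positivity),
            ← ENNReal.ofReal_pow (by positivity), ← mul_assoc, ← mul_assoc,
            ← ENNReal.ofReal_mul (by positivity), ← ENNReal.ofReal_mul (by positivity)]
          congr 2; ring
      _ = ENNReal.ofReal D ^ 2 * H * (ENNReal.ofReal q ^ m) ^ 2 := by
          rw [mul_right_comm, ← ENNReal.ofReal_pow hq0.le, ← ENNReal.ofReal_pow hD0.le,
            ← ENNReal.ofReal_pow (by positivity), ← ENNReal.ofReal_mul (by positivity)]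
          congr 2
          have a1 : (4 : ℝ) ^ s = (2 ^ s) ^ 2 := by
            rw [show (4 : ℝ) = 2 * 2 by norm_num, Real.mul_rpow (by norm_num) (by norm_num)]; ring
          have a2 : q = 2 * (2 ^ s)⁻¹ := by
            rw [hq, Real.rpow_sub (by norm_num), Real.rpow_one, div_eq_mul_inv]
          have a3 : ((4 : ℝ) ^ m) ^ (-s) = (((2 ^ s) ^ 2)⁻¹) ^ m := by
            rw [← a1, Real.rpow_neg (by positivity), ← Real.rpow_natCast, ← Real.rpow_mul (by norm_num),
              mul_comm, Real.rpow_mul (by norm_num), Real.rpow_natCast, inv_pow]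
          rw [a3, a1, a2, hD]
          have : (0 : ℝ) < 2 ^ s := by positivity
          generalize (2 : ℝ) ^ s = t at *
          rw [show ((t ^ 2)⁻¹) ^ m = ((t⁻¹) ^ m) ^ 2 by
            rw [← inv_pow, ← pow_mul, ← pow_mul, mul_comm], mul_pow 2 t⁻¹ m]
          ring
  rw [nh_B1_eq]
  refine (ENNReal.tsum_le_tsum hterm).trans (le_of_eq ?_)
  rw [ENNReal.tsum_mul_left, ENNReal.tsum_geometric, ENNReal.ofReal_mul hD0.le,
    ENNReal.ofReal_inv_of_pos (by linarith), ENNReal.ofReal_sub _ hq0.le, ENNReal.ofReal_one]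
  ring

theorem nh_Y_le_Z (φ : ℝ → ℝ) (hφ : IsCutoff φ) :
    ∃ C : ℝ, 0 < C ∧ ∀ F : FunRT, Ynorm (1 / 2) F ≤ ENNReal.ofReal C * Znorm φ F := by
  refine ⟨4, by norm_num, fun F => ?_⟩
  unfold Ynorm Znorm
  refine iSup_le fun ξ => ?_
  refine le_trans ?_ (mul_le_mul_right (le_iSup (fun ξ : ℝ => ENNReal.ofReal (1 + ξ ^ 2) *
    B1Norm φ fun p => ftx (F p) ξ) ξ) _)
  rw [mul_left_comm]
  gcongr
  apply nh_le_of_sq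
  rw [nh_sqrt_sq]
  refine (nh_besov_lower hφ (fun p => ftx (F p) ξ)).trans ?_
  rw [mul_pow, ← ENNReal.ofReal_pow (by norm_num)]
  gcongr
  rw [show (15 : ℝ≥0∞) = ENNReal.ofReal 15 by simp]
  exact ENNReal.ofReal_le_ofReal (by norm_num)

theorem nh_Z_le_Y (φ : ℝ → ℝ) (hφ : IsCutoff φ) (s : ℝ) (hs : 1 < s) :
    ∃ C : ℝ, 0 < C ∧ ∀ F : FunRT, Znorm φ F ≤ ENNReal.ofReal C * Ynorm s F := by
  obtain ⟨C, hC, h⟩ := nh_besov_upper hφ hs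
  refine ⟨C, hC, fun F => ?_⟩
  unfold Ynorm Znorm
  refine iSup_le fun ξ => ?_
  refine le_trans ?_ (mul_le_mul_right (le_iSup (fun ξ : ℝ => ENNReal.ofReal (1 + ξ ^ 2) *
    (∑' p : ℤ, ENNReal.ofReal ((1 + (p : ℝ) ^ 2) ^ s) * (‖ftx (F p) ξ‖₊ : ℝ≥0∞) ^ 2) ^ (1 / 2 : ℝ)) ξ) _)
  rw [mul_left_comm]
  gcongr
  exact h _

theorem nh_H_le_Y (F : FunRT) : HsNorm (1 / 2) F ≤ ENNReal.ofReal Real.pi * Ynorm (1 / 2) F := by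
  apply nh_le_of_sq
  unfold HsNorm
  rw [nh_sqrt_sq]
  set Y := Ynorm (1 / 2) F with hY
  have hm : ∀ p : ℤ, Measurable (fun ξ : ℝ => ENNReal.ofReal ((1 + ξ ^ 2 + (p : ℝ) ^ 2) ^ (1 / 2 : ℝ)) *
      (‖ftx (F p) ξ‖₊ : ℝ≥0∞) ^ 2) := by
    intro p
    have := (nh_ftx_continuous (F p)).enorm.measurable.pow_const 2
    refine Measurable.mul ?_ this
    apply Measurable.ennreal_ofReal
    fun_prop
  rw [← lintegral_tsum (fun p => (hm p).aemeasurable)]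
  have hpt : ∀ ξ : ℝ, ∑' p : ℤ, ENNReal.ofReal ((1 + ξ ^ 2 + (p : ℝ) ^ 2) ^ (1 / 2 : ℝ)) *
      (‖ftx (F p) ξ‖₊ : ℝ≥0∞) ^ 2 ≤ ENNReal.ofReal ((1 + ξ ^ 2)⁻¹) * Y ^ 2 := by
    intro ξ
    set S := ∑' p : ℤ, ENNReal.ofReal ((1 + (p : ℝ) ^ 2) ^ (1 / 2 : ℝ)) * (‖ftx (F p) ξ‖₊ : ℝ≥0∞) ^ 2 with hS
    have hle : ENNReal.ofReal (1 + ξ ^ 2) * S ^ (1 / 2 : ℝ) ≤ Y := by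
      rw [hY]; unfold Ynorm
      exact le_iSup (fun ξ : ℝ => ENNReal.ofReal (1 + ξ ^ 2) *
        (∑' p : ℤ, ENNReal.ofReal ((1 + (p : ℝ) ^ 2) ^ (1 / 2 : ℝ)) *
          (‖ftx (F p) ξ‖₊ : ℝ≥0∞) ^ 2) ^ (1 / 2 : ℝ)) ξ
    have hle2 : ENNReal.ofReal (1 + ξ ^ 2) ^ 2 * S ≤ Y ^ 2 := by
      calc _ = (ENNReal.ofReal (1 + ξ ^ 2) * S ^ (1 / 2 : ℝ)) ^ 2 := by rw [mul_pow, nh_sqrt_sq]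
        _ ≤ _ := by gcongr
    have hx : (1 : ℝ) ≤ 1 + ξ ^ 2 := by nlinarith [sq_nonneg ξ]
    calc _ ≤ ENNReal.ofReal (1 + ξ ^ 2) * S := by
          rw [hS, ← ENNReal.tsum_mul_left]
          refine ENNReal.tsum_le_tsum fun p => ?_
          rw [← mul_assoc, ← ENNReal.ofReal_mul (by positivity)]
          gcongr
          calc (1 + ξ ^ 2 + (p : ℝ) ^ 2) ^ (1 / 2 : ℝ)
              ≤ ((1 + ξ ^ 2) * (1 + (p : ℝ) ^ 2)) ^ (1 / 2 : ℝ) := by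
                apply Real.rpow_le_rpow (by positivity) _ (by norm_num)
                nlinarith [mul_nonneg (sq_nonneg ξ) (sq_nonneg (p : ℝ))]
            _ = (1 + ξ ^ 2) ^ (1 / 2 : ℝ) * (1 + (p : ℝ) ^ 2) ^ (1 / 2 : ℝ) :=
                Real.mul_rpow (by positivity) (by positivity)
            _ ≤ _ := by
                gcongr
                calc (1 + ξ ^ 2) ^ (1 / 2 : ℝ) ≤ (1 + ξ ^ 2) ^ (1 : ℝ) :=
                      Real.rpow_le_rpow_of_exponent_le hx (by norm_num)
                  _ = _ := Real.rpow_one _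
      _ = ENNReal.ofReal ((1 + ξ ^ 2)⁻¹) * (ENNReal.ofReal (1 + ξ ^ 2) ^ 2 * S) := by
          rw [← ENNReal.ofReal_pow (by positivity), ← mul_assoc, ← ENNReal.ofReal_mul (by positivity)]
          congr 2
          field_simp
      _ ≤ _ := by gcongr
  refine (lintegral_mono hpt).trans ?_
  rw [lintegral_mul_const _ (by fun_prop), ← ofReal_integral_eq_lintegral_ofReal integrable_inv_one_add_sq
    (by filter_upwards with ξ; positivity), integral_univ_inv_one_add_sq, mul_pow,
    ← ENNReal.ofReal_pow (by positivity)]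
  gcongr
  nlinarith [Real.pi_gt_three]

theorem nh_Y_le_S (N : ℕ) (hN : 13 ≤ N) (F : FunRT) :
    Ynorm 2 F ≤ ENNReal.ofReal (2 * Real.pi) * Snorm N F := by
  unfold Ynorm
  refine iSup_le fun ξ => ?_
  apply nh_le_of_sq
  rw [mul_pow, nh_sqrt_sq, ← ENNReal.tsum_mul_left]
  have hone : (1 : ℝ≥0∞) ≤ ENNReal.ofReal (2 * Real.pi) := by
    rw [← ENNReal.ofReal_one]
    exact ENNReal.ofReal_le_ofReal (by linarith [Real.pi_gt_three])
  have hH : ∑' p : ℤ, ∫⁻ ξ : ℝ, ENNReal.ofReal ((1 + ξ ^ 2 + (p : ℝ) ^ 2) ^ (N : ℝ)) *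
      (‖ftx (F p) ξ‖₊ : ℝ≥0∞) ^ 2 = HsNorm N F ^ 2 := by
    unfold HsNorm; rw [nh_sqrt_sq]
  have hL : ∑' p : ℤ, ∫⁻ x : ℝ, (‖(x : ℂ) * F p x‖₊ : ℝ≥0∞) ^ 2 = L2norm (xMul F) ^ 2 := by
    unfold L2norm; rw [nh_sqrt_sq]; rfl
  set κ := ENNReal.ofReal (2 * Real.pi) with hκ
  calc _ ≤ ∑' p : ℤ, (κ * (∫⁻ x : ℝ, (‖(x : ℂ) * F p x‖₊ : ℝ≥0∞) ^ 2) +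
        ∫⁻ ξ : ℝ, ENNReal.ofReal ((1 + ξ ^ 2 + (p : ℝ) ^ 2) ^ (N : ℝ)) *
      (‖ftx (F p) ξ‖₊ : ℝ≥0∞) ^ 2) := by
        refine ENNReal.tsum_le_tsum fun p => ?_
        refine le_trans (le_of_eq ?_) (nh_mode (F p) p N hN ξ)
        rw [← mul_assoc, ← ENNReal.ofReal_pow (by positivity), ← ENNReal.ofReal_mul (by positivity)]
        norm_cast
    _ = κ * L2norm (xMul F) ^ 2 + HsNorm N F ^ 2 := by
        rw [ENNReal.tsum_add, ENNReal.tsum_mul_left, hH, hL]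
    _ ≤ κ ^ 2 * L2norm (xMul F) ^ 2 + κ ^ 2 * HsNorm N F ^ 2 := by
        gcongr
        · exact le_self_pow hone (by norm_num)
        · calc HsNorm N F ^ 2 = 1 * HsNorm N F ^ 2 := (one_mul _).symm
            _ ≤ _ := by gcongr; exact one_le_pow₀ hone
    _ ≤ (κ * Snorm N F) ^ 2 := by
        unfold Snorm
        rw [mul_pow, ← mul_add]
        gcongr
        rw [add_sq', add_comm]
        exact le_self_add

/-- **Hierarchy of norms:** `‖F‖_{Y^{1/2}} ≲ ‖F‖_Z`, `‖F‖_Z ≲_s ‖F‖_{Y^s}` for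
`s > 1`, and `‖F‖_{H^{1/2}} ≲ ‖F‖_Z ≲ ‖F‖_S ≲ ‖F‖_{S⁺}`. -/
theorem norm_hierarchy (N : ℕ) (hN : 13 ≤ N) (φ : ℝ → ℝ) (hφ : IsCutoff φ) :
    (∃ C : ℝ, 0 < C ∧ ∀ F : FunRT,
        Ynorm (1 / 2) F ≤ ENNReal.ofReal C * Znorm φ F) ∧
    (∀ s : ℝ, 1 < s → ∃ C : ℝ, 0 < C ∧ ∀ F : FunRT,
        Znorm φ F ≤ ENNReal.ofReal C * Ynorm s F) ∧
    (∃ C : ℝ, 0 < C ∧ ∀ F : FunRT,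
        HsNorm (1 / 2) F ≤ ENNReal.ofReal C * Znorm φ F ∧
        Znorm φ F ≤ ENNReal.ofReal C * Snorm N F ∧
        Snorm N F ≤ ENNReal.ofReal C * SplusNorm N F) := by
  obtain ⟨C1, hC1, h1⟩ := nh_Y_le_Z φ hφ
  have h2 := nh_Z_le_Y φ hφ
  obtain ⟨C2, hC2, h2'⟩ := h2 2 (by norm_num)
  refine ⟨⟨C1, hC1, h1⟩, h2, Real.pi * C1 + C2 * (2 * Real.pi) + 1, by positivity, fun F => ⟨?_, ?_, ?_⟩⟩
  · refine (nh_H_le_Y F).trans ?_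
    calc ENNReal.ofReal Real.pi * Ynorm (1 / 2) F
        ≤ ENNReal.ofReal Real.pi * (ENNReal.ofReal C1 * Znorm φ F) := by gcongr; exact h1 F
      _ = ENNReal.ofReal (Real.pi * C1) * Znorm φ F := by
          rw [← mul_assoc, ← ENNReal.ofReal_mul (by positivity)]
      _ ≤ _ := by
          gcongr
          have : 0 < C2 * (2 * Real.pi) := by positivity
          linarith
  · calc Znorm φ F ≤ ENNReal.ofReal C2 * Ynorm 2 F := h2' F
      _ ≤ ENNReal.ofReal C2 * (ENNReal.ofReal (2 * Real.pi) * Snorm N F) := by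
          gcongr; exact nh_Y_le_S N hN F
      _ = ENNReal.ofReal (C2 * (2 * Real.pi)) * Snorm N F := by
          rw [← mul_assoc, ← ENNReal.ofReal_mul (by positivity)]
      _ ≤ _ := by
          gcongr
          have : 0 < Real.pi * C1 := by positivity
          linarith
  · calc Snorm N F ≤ SplusNorm N F := by
          unfold SplusNorm; rw [add_assoc]; exact le_self_add
      _ = ENNReal.ofReal 1 * SplusNorm N F := by simp
      _ ≤ _ := by
          gcongr
          have : 0 < Real.pi * C1 + C2 * (2 * Real.pi) := by positivity
          linarith

end
end

section
/- Fix 0 < δ < 10⁻³. Let T > 1 and let φ ∈ C_c^∞(ℝ) with φ(x) = 1 for |x| ≤ 1 and φ(x) = 0 for |x| ≥ 2. For T/2 ≤ t ≤ T define m̃(η,κ) := φ(t^{1/4}ηκ)·φ((10T)^{−1/6}η)·φ((10T)^{−1/6}κ). Then ‖F_{η,κ}m̃‖_{L¹(ℝ²)} ≲ t^{δ/100}, uniformly in T > 1 and T/2 ≤ t ≤ T. -/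
open scoped ENNReal NNReal BigOperators
open MeasureTheory Filter

noncomputable section

/-- The inverse Fourier transform on `ℝ²` (up to a constant). -/
def invFT2 (m : ℝ × ℝ → ℂ) (w : ℝ × ℝ) : ℂ :=
  ∫ η : ℝ, ∫ κ : ℝ, Complex.exp (Complex.I * (w.1 * η + w.2 * κ)) * m (η, κ)

/-- The phase. -/
def phs (w z : ℝ × ℝ) : ℂ := Complex.exp (Complex.I * (w.1 * z.1 + w.2 * z.2))

lemma norm_phs (w z : ℝ × ℝ) : ‖phs w z‖ = 1 := by
  have := Complex.norm_exp_ofReal_mul_I (w.1 * z.1 + w.2 * z.2)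
  rw [phs, mul_comm]
  push_cast at this
  exact this

lemma contDiff_phs (w : ℝ × ℝ) : ContDiff ℝ (⊤ : ℕ∞) (phs w) := by
  unfold phs
  have h1 : ContDiff ℝ (⊤ : ℕ∞) (fun z : ℝ × ℝ => ((z.1 : ℝ) : ℂ)) :=
    Complex.ofRealCLM.contDiff.comp contDiff_fst
  have h2 : ContDiff ℝ (⊤ : ℕ∞) (fun z : ℝ × ℝ => ((z.2 : ℝ) : ℂ)) :=
    Complex.ofRealCLM.contDiff.comp contDiff_snd
  exact Complex.contDiff_exp.comp
    (contDiff_const.mul ((contDiff_const.mul h1).add (contDiff_const.mul h2)))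

lemma fderiv_phs (w z v : ℝ × ℝ) :
    fderiv ℝ (phs w) z v = Complex.I * (w.1 * v.1 + w.2 * v.2) * phs w z := by
  have h1 : HasFDerivAt (fun z : ℝ × ℝ => ((z.1 : ℝ) : ℂ))
      (Complex.ofRealCLM.comp (ContinuousLinearMap.fst ℝ ℝ ℝ)) z :=
    (Complex.ofRealCLM.comp (ContinuousLinearMap.fst ℝ ℝ ℝ)).hasFDerivAt
  have h2 : HasFDerivAt (fun z : ℝ × ℝ => ((z.2 : ℝ) : ℂ))
      (Complex.ofRealCLM.comp (ContinuousLinearMap.snd ℝ ℝ ℝ)) z :=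
    (Complex.ofRealCLM.comp (ContinuousLinearMap.snd ℝ ℝ ℝ)).hasFDerivAt
  have h := (((h1.const_mul (w.1 : ℂ)).add (h2.const_mul (w.2 : ℂ))).const_mul Complex.I).cexp
  have h' : HasFDerivAt (phs w) _ z := h
  rw [h'.fderiv]
  simp [phs]
  ring

lemma invFT2_eq {m : ℝ × ℝ → ℂ} (hm : Continuous m) (hs : HasCompactSupport m) (w : ℝ × ℝ) :
    invFT2 m w = ∫ z : ℝ × ℝ, phs w z * m z := by
  have hi : Integrable (fun z : ℝ × ℝ => phs w z * m z) :=
    ((contDiff_phs w).continuous.mul hm).integrable_of_hasCompactSupport hs.mul_left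
  rw [Measure.volume_eq_prod] at hi ⊢
  rw [integral_prod _ hi]
  rfl

lemma integrable_phs_mul {m : ℝ × ℝ → ℂ} (hm : Continuous m) (hs : HasCompactSupport m)
    (w : ℝ × ℝ) : Integrable (fun z : ℝ × ℝ => phs w z * m z) :=
  ((contDiff_phs w).continuous.mul hm).integrable_of_hasCompactSupport hs.mul_left

/-- L1 norm of the inverse Fourier transform. -/
def NN (m : ℝ × ℝ → ℂ) : ℝ≥0∞ := ∫⁻ w : ℝ × ℝ, (‖invFT2 m w‖₊ : ℝ≥0∞)

lemma measurable_invFT2 {m : ℝ × ℝ → ℂ} (hm : Continuous m) (hs : HasCompactSupport m) :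
    Measurable (invFT2 m) := by
  have : invFT2 m = fun w => ∫ z : ℝ × ℝ, phs w z * m z := by
    ext w; exact invFT2_eq hm hs w
  rw [this]
  have hc : Continuous (fun p : (ℝ × ℝ) × (ℝ × ℝ) => phs p.1 p.2 * m p.2) := by
    unfold phs
    fun_prop
  exact (hc.stronglyMeasurable.integral_prod_right (ν := volume)).measurable

lemma NN_add {m n : ℝ × ℝ → ℂ} (hm : Continuous m) (hs : HasCompactSupport m)
    (hn : Continuous n) (ht : HasCompactSupport n) :
    NN (fun z => m z + n z) ≤ NN m + NN n := by
  unfold NN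
  rw [← lintegral_add_left (measurable_invFT2 hm hs).nnnorm.coe_nnreal_ennreal]
  apply lintegral_mono
  intro w
  have : invFT2 (fun z => m z + n z) w = invFT2 m w + invFT2 n w := by
    have h0 : invFT2 (fun z => m z + n z) w = ∫ z : ℝ × ℝ, phs w z * (m z + n z) :=
      invFT2_eq (hm.add hn) (hs.add ht) w
    rw [h0, invFT2_eq hm hs, invFT2_eq hn ht,
      ← integral_add (integrable_phs_mul hm hs w) (integrable_phs_mul hn ht w)]
    congr 1; ext z; ring
  simp only [this]
  exact_mod_cast nnnorm_add_le _ _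

lemma invFT2_scale (m : ℝ × ℝ → ℂ) {a b : ℝ} (ha : 0 < a) (hb : 0 < b) (w : ℝ × ℝ) :
    invFT2 (fun z => m (a * z.1, b * z.2)) w =
      ((a⁻¹ * b⁻¹ : ℝ) : ℂ) * invFT2 m (a⁻¹ * w.1, b⁻¹ * w.2) := by
  unfold invFT2
  have h1 : ∀ η : ℝ, ∫ κ : ℝ, Complex.exp (Complex.I * (w.1 * η + w.2 * κ)) * m (a * η, b * κ)
      = |b⁻¹| • ∫ κ : ℝ, Complex.exp (Complex.I * (w.1 * η + ((b⁻¹ * w.2 : ℝ) : ℂ) * κ))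
        * m (a * η, κ) := by
    intro η
    rw [← Measure.integral_comp_mul_left]
    congr 1; ext κ
    congr 3
    push_cast
    have : (b : ℂ) ≠ 0 := by exact_mod_cast hb.ne'
    field_simp
  simp only [h1]
  have h2 := Measure.integral_comp_mul_left (fun η : ℝ => |b⁻¹| • ∫ κ : ℝ,
    Complex.exp (Complex.I * (((a⁻¹ * w.1 : ℝ) : ℂ) * η + ((b⁻¹ * w.2 : ℝ) : ℂ) * κ))
        * m (η, κ)) a
  have h3 : ∀ η : ℝ, (((a⁻¹ * w.1 : ℝ) : ℂ) * ((a * η : ℝ) : ℂ)) = w.1 * η := by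
    intro η
    push_cast
    have : (a : ℂ) ≠ 0 := by exact_mod_cast ha.ne'
    field_simp
  simp only [h3] at h2
  rw [h2, integral_smul, abs_of_pos (inv_pos.2 ha), abs_of_pos (inv_pos.2 hb), smul_smul,
    Complex.real_smul]

lemma lintegral_scale (f : ℝ × ℝ → ℝ≥0∞) {a b : ℝ} (ha : 0 < a) (hb : 0 < b) :
    ∫⁻ w : ℝ × ℝ, f (a⁻¹ * w.1, b⁻¹ * w.2) = ENNReal.ofReal (a * b) * ∫⁻ w, f w := by
  let e : ℝ × ℝ ≃ᵐ ℝ × ℝ :=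
    ((Homeomorph.mulLeft₀ a⁻¹ (inv_ne_zero ha.ne')).toMeasurableEquiv).prodCongr
      ((Homeomorph.mulLeft₀ b⁻¹ (inv_ne_zero hb.ne')).toMeasurableEquiv)
  have he : Measure.map e volume = ENNReal.ofReal (a * b) • (volume : Measure (ℝ × ℝ)) := by
    have h := Measure.map_prod_map (volume : Measure ℝ) (volume : Measure ℝ)
      (measurable_const_mul a⁻¹) (measurable_const_mul b⁻¹)
    rw [Real.map_volume_mul_left (inv_ne_zero ha.ne'),
      Real.map_volume_mul_left (inv_ne_zero hb.ne'), inv_inv, inv_inv, abs_of_pos ha,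
      abs_of_pos hb, Measure.prod_smul_left, Measure.prod_smul_right, smul_smul,
      ← ENNReal.ofReal_mul ha.le] at h
    exact h.symm
  have := lintegral_map_equiv (μ := volume) f e
  rw [he, lintegral_smul_measure] at this
  exact this.symm

lemma NN_scale (m : ℝ × ℝ → ℂ) {a b : ℝ} (ha : 0 < a) (hb : 0 < b) :
    NN (fun z => m (a * z.1, b * z.2)) = NN m := by
  unfold NN
  simp only [invFT2_scale m ha hb, nnnorm_mul, ENNReal.coe_mul]
  rw [lintegral_const_mul' _ _ ENNReal.coe_ne_top,
    lintegral_scale (fun w => (‖invFT2 m w‖₊ : ℝ≥0∞)) ha hb, ← mul_assoc]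
  have : (‖((a⁻¹ * b⁻¹ : ℝ) : ℂ)‖₊ : ℝ≥0∞) * ENNReal.ofReal (a * b) = 1 := by
    rw [← enorm_eq_nnnorm, ← ofReal_norm, Complex.norm_real, Real.norm_of_nonneg
      (by positivity), ← ENNReal.ofReal_mul (by positivity)]
    have : a⁻¹ * b⁻¹ * (a * b) = 1 := by field_simp
    rw [this, ENNReal.ofReal_one]
  rw [this, one_mul]

/-- Admissible families. -/
structure Fam (K : Set (ℝ × ℝ)) (M : ℝ × (ℝ × ℝ) → ℂ) : Prop where
  smooth : ContDiff ℝ (⊤ : ℕ∞) M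
  zero : ∀ p ∈ Set.Icc (0 : ℝ) 1, ∀ z, z ∉ K → M (p, z) = 0

/-- Directional derivative in the space variables. -/
def dd (v : ℝ × ℝ) (M : ℝ × (ℝ × ℝ) → ℂ) : ℝ × (ℝ × ℝ) → ℂ := fun q => fderiv ℝ M q (0, v)

lemma dd_eq {K : Set (ℝ × ℝ)} {M : ℝ × (ℝ × ℝ) → ℂ} (h : Fam K M) (v : ℝ × ℝ) (p : ℝ)
    (z : ℝ × ℝ) : fderiv ℝ (fun z => M (p, z)) z v = dd v M (p, z) := by
  have h1 : HasFDerivAt M (fderiv ℝ M (p, z)) (p, z) :=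
    ((h.smooth.differentiable (by simp)) (p, z)).hasFDerivAt
  have h2 := h1.comp z (hasFDerivAt_prodMk_right p z)
  have h3 : HasFDerivAt (fun z => M (p, z)) _ z := h2
  rw [h3.fderiv]
  simp [dd]

lemma Fam.dd {K : Set (ℝ × ℝ)} {M : ℝ × (ℝ × ℝ) → ℂ} (hK : IsClosed K) (h : Fam K M)
    (v : ℝ × ℝ) : Fam K (dd v M) := by
  refine ⟨(h.smooth.fderiv_right (m := (⊤ : ℕ∞)) (by simp)).clm_apply contDiff_const, ?_⟩
  intro p hp z hz
  rw [← dd_eq h]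
  have : (fun z => M (p, z)) =ᶠ[nhds z] fun _ => 0 := by
    filter_upwards [hK.isOpen_compl.mem_nhds hz] with y hy
    exact h.zero p hp y hy
  rw [this.fderiv_eq]
  simp

lemma Fam.cpt {K : Set (ℝ × ℝ)} {M : ℝ × (ℝ × ℝ) → ℂ} (hK : IsCompact K) (h : Fam K M)
    {p : ℝ} (hp : p ∈ Set.Icc (0 : ℝ) 1) : HasCompactSupport (fun z => M (p, z)) :=
  HasCompactSupport.intro hK (fun z hz => h.zero p hp z hz)

lemma Fam.cont {K : Set (ℝ × ℝ)} {M : ℝ × (ℝ × ℝ) → ℂ} (h : Fam K M)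
    (p : ℝ) : Continuous (fun z => M (p, z)) :=
  h.smooth.continuous.comp (by fun_prop)

/-- Oscillatory integral. -/
def JJ (M : ℝ × (ℝ × ℝ) → ℂ) (p : ℝ) (w : ℝ × ℝ) : ℂ := ∫ z : ℝ × ℝ, phs w z * M (p, z)

lemma Fam.JJ_bound {K : Set (ℝ × ℝ)} {M : ℝ × (ℝ × ℝ) → ℂ} (hK : IsCompact K) (h : Fam K M) :
    ∃ C : ℝ, ∀ p ∈ Set.Icc (0 : ℝ) 1, ∀ w, ‖JJ M p w‖ ≤ C := by
  obtain ⟨C, hC⟩ := ((isCompact_Icc (a := (0 : ℝ)) (b := 1)).prod hK).exists_bound_of_continuousOn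
    h.smooth.continuous.continuousOn
  refine ⟨C * volume.real K, fun p hp w => ?_⟩
  unfold JJ
  rw [← setIntegral_eq_integral_of_forall_compl_eq_zero (s := K)
    (fun z hz => by rw [h.zero p hp z hz, mul_zero])]
  apply norm_setIntegral_le_of_norm_le_const hK.measure_lt_top
  intro z hz
  rw [norm_mul, norm_phs, one_mul]
  exact hC (p, z) ⟨hp, hz⟩

lemma Fam.JJ_dd {K : Set (ℝ × ℝ)} {M : ℝ × (ℝ × ℝ) → ℂ} (hK : IsCompact K) (h : Fam K M)
    (v : ℝ × ℝ) {p : ℝ} (hp : p ∈ Set.Icc (0 : ℝ) 1) (w : ℝ × ℝ) :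
    JJ (_root_.dd v M) p w = -(Complex.I * (w.1 * v.1 + w.2 * v.2)) * JJ M p w := by
  have hd := h.dd hK.isClosed v
  have i1 := integrable_phs_mul (h.cont p) (h.cpt hK hp) w
  have i2 := integrable_phs_mul (hd.cont p) (hd.cpt hK hp) w
  have key := integral_mul_fderiv_eq_neg_fderiv_mul_of_integrable (μ := (volume : Measure (ℝ × ℝ)))
    (f := phs w) (g := fun z => M (p, z)) (v := v)
    (by simp only [fderiv_phs, mul_assoc]
        simpa only [mul_assoc] using i1.const_mul (Complex.I * (w.1 * v.1 + w.2 * v.2)))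
    (by simpa only [dd_eq h] using i2) i1
    (fun x _ => (contDiff_phs w).differentiable (by simp) x)
    (fun x _ => (h.smooth.comp (contDiff_prodMk_right p)).differentiable (by simp) x)
  simp only [dd_eq h, fderiv_phs] at key
  unfold JJ
  rw [key, neg_mul, ← integral_const_mul]
  simp only [mul_assoc]

lemma Fam.NN_bound {K : Set (ℝ × ℝ)} {M : ℝ × (ℝ × ℝ) → ℂ} (hK : IsCompact K) (h : Fam K M) :
    ∃ C : ℝ≥0, ∀ p ∈ Set.Icc (0 : ℝ) 1, NN (fun z => M (p, z)) ≤ C := by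
  have hc := hK.isClosed
  let e1 : ℝ × ℝ := (1, 0)
  let e2 : ℝ × ℝ := (0, 1)
  have ha := h.dd hc e1
  have h1 := ha.dd hc e1
  have hb := h.dd hc e2
  have h2 := hb.dd hc e2
  have hd := h2.dd hc e1
  have h3 := hd.dd hc e1
  obtain ⟨C0, hC0⟩ := h.JJ_bound hK
  obtain ⟨C1, hC1⟩ := h1.JJ_bound hK
  obtain ⟨C2, hC2⟩ := h2.JJ_bound hK
  obtain ⟨C3, hC3⟩ := h3.JJ_bound hK
  have hIw : Integrable (fun w : ℝ × ℝ => (1 + w.1 ^ 2)⁻¹ * (1 + w.2 ^ 2)⁻¹) :=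
    integrable_inv_one_add_sq.mul_prod integrable_inv_one_add_sq
  have hIw' := hIw.const_mul (C0 + C1 + C2 + C3)
  refine ⟨(∫⁻ w : ℝ × ℝ, ‖(C0 + C1 + C2 + C3) *
    ((1 + w.1 ^ 2)⁻¹ * (1 + w.2 ^ 2)⁻¹)‖ₑ).toNNReal, fun p hp => ?_⟩
  rw [ENNReal.coe_toNNReal hIw'.2.ne]
  unfold NN
  apply lintegral_mono
  intro w
  simp only []
  rw [← enorm_eq_nnnorm, enorm_le_iff_norm_le, invFT2_eq (h.cont p) (h.cpt hK hp)]
  change ‖JJ M p w‖ ≤ _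
  refine le_trans ?_ (le_abs_self _)
  have b0 := hC0 p hp w
  have b1 := hC1 p hp w
  have b2 := hC2 p hp w
  have b3 := hC3 p hp w
  rw [ha.JJ_dd hK e1 hp, h.JJ_dd hK e1 hp] at b1
  rw [hd.JJ_dd hK e1 hp, h2.JJ_dd hK e1 hp, hb.JJ_dd hK e2 hp, h.JJ_dd hK e2 hp] at b3
  rw [hb.JJ_dd hK e2 hp, h.JJ_dd hK e2 hp] at b2
  simp only [e1, e2, Complex.ofReal_one, Complex.ofReal_zero, mul_one, mul_zero, add_zero,
    zero_add, norm_mul, norm_neg, Complex.norm_I, one_mul, Complex.norm_real,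
    Real.norm_eq_abs] at b1 b2 b3
  rw [← mul_assoc, abs_mul_abs_self] at b1 b2
  rw [← mul_assoc, abs_mul_abs_self, ← mul_assoc |w.2|, abs_mul_abs_self] at b3
  rw [← mul_inv, ← div_eq_mul_inv, le_div_iff₀ (by positivity)]
  nlinarith

lemma main_cutoff (φ : ℝ → ℝ) (hφ : IsCutoff φ) : ∃ C : ℝ≥0, ∀ n : ℕ, ∀ Λ : ℝ, 0 < Λ → Λ ≤ 2 ^ n →
    NN (fun z => ((φ (Λ * z.1 * z.2) * φ z.1 * φ z.2 : ℝ) : ℂ)) ≤ C * (n + 1 : ℕ) := by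
  have hs := hφ.smooth
  have hcont := hs.continuous
  let M1 : ℝ × (ℝ × ℝ) → ℂ := fun q => ((φ (q.1 * q.2.1 * q.2.2) * φ q.2.1 * φ q.2.2 : ℝ) : ℂ)
  let M2 : ℝ × (ℝ × ℝ) → ℂ := fun q =>
    ((φ (q.2.1 * q.2.2) * (φ q.2.1 - φ (2 * q.2.1)) * φ (q.1 * q.2.2) : ℝ) : ℂ)
  let K : Set (ℝ × ℝ) := Set.Icc (-4) 4 ×ˢ Set.Icc (-4) 4
  have hK : IsCompact K := isCompact_Icc.prod isCompact_Icc
  have hKm : ∀ z : ℝ × ℝ, |z.1| ≤ 4 → |z.2| ≤ 4 → z ∈ K := fun z h1 h2 =>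
    ⟨abs_le.1 h1, abs_le.1 h2⟩
  have h1 : Fam K M1 := by
    have hr : ContDiff ℝ (⊤ : ℕ∞) (fun q : ℝ × (ℝ × ℝ) =>
        φ (q.1 * q.2.1 * q.2.2) * φ q.2.1 * φ q.2.2) := by fun_prop
    refine ⟨Complex.ofRealCLM.contDiff.comp hr, ?_⟩
    · intro p hp z hz
      by_contra hne
      apply hz
      simp only [M1, Complex.ofReal_eq_zero, mul_eq_zero, not_or] at hne
      apply hKm
      · by_contra hh
        exact hne.1.2 (hφ.eq_zero _ (by linarith))
      · by_contra hh
        exact hne.2 (hφ.eq_zero _ (by linarith))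
  have h2 : Fam K M2 := by
    have hr : ContDiff ℝ (⊤ : ℕ∞) (fun q : ℝ × (ℝ × ℝ) =>
        φ (q.2.1 * q.2.2) * (φ q.2.1 - φ (2 * q.2.1)) * φ (q.1 * q.2.2)) := by fun_prop
    refine ⟨Complex.ofRealCLM.contDiff.comp hr, ?_⟩
    · intro p hp z hz
      by_contra hne
      apply hz
      simp only [M2, Complex.ofReal_eq_zero, mul_eq_zero, not_or] at hne
      have hz1 : |z.1| < 2 := by
        by_contra! hh
        apply hne.1.2
        rw [hφ.eq_zero _ hh, hφ.eq_zero _ (by rw [abs_mul, abs_two]; linarith), sub_zero]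
      have hz2 : 1 / 2 < |z.1| := by
        by_contra! hh
        apply hne.1.2
        rw [hφ.eq_one _ (by linarith), hφ.eq_one _ (by rw [abs_mul, abs_two]; linarith), sub_self]
      have hz3 : |z.1 * z.2| < 2 := by
        by_contra! hh
        exact hne.1.1 (hφ.eq_zero _ hh)
      rw [abs_mul] at hz3
      apply hKm
      · linarith
      · nlinarith [abs_nonneg z.2]
  obtain ⟨C1, hC1⟩ := h1.NN_bound hK
  obtain ⟨C2, hC2⟩ := h2.NN_bound hK
  have hsupp : ∀ z : ℝ × ℝ, z ∉ K → φ z.1 * φ z.2 = 0 := by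
    intro z hz
    by_contra hne
    apply hz
    simp only [mul_eq_zero, not_or] at hne
    apply hKm
    · by_contra hh
      exact hne.1 (hφ.eq_zero _ (by linarith))
    · by_contra hh
      exact hne.2 (hφ.eq_zero _ (by linarith))
  refine ⟨C1 + C2, fun n => ?_⟩
  have base : ∀ Λ : ℝ, 0 < Λ → Λ ≤ 1 →
    NN (fun z => ((φ (Λ * z.1 * z.2) * φ z.1 * φ z.2 : ℝ) : ℂ)) ≤ C1 := fun Λ h0 h1 =>
      hC1 Λ ⟨h0.le, h1⟩
  induction n with
  | zero =>
    intro Λ h0 hΛ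
    refine (base Λ h0 (by simpa using hΛ)).trans ?_
    simp
  | succ n ih =>
    intro Λ h0 hΛ
    by_cases hΛ1 : Λ ≤ 1
    · refine (base Λ h0 hΛ1).trans ?_
      calc (C1 : ℝ≥0∞) ≤ ((C1 + C2 : ℝ≥0) : ℝ≥0∞) * 1 := by simp
        _ ≤ _ := by gcongr; simp
    push Not at hΛ1
    let P : ℝ × ℝ → ℂ := fun z => ((φ (Λ * z.1 * z.2) * φ (2 * z.1) * φ z.2 : ℝ) : ℂ)
    let Q : ℝ × ℝ → ℂ := fun z =>
      ((φ (Λ * z.1 * z.2) * (φ z.1 - φ (2 * z.1)) * φ z.2 : ℝ) : ℂ)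
    have hsum : (fun z : ℝ × ℝ => ((φ (Λ * z.1 * z.2) * φ z.1 * φ z.2 : ℝ) : ℂ)) =
        fun z => P z + Q z := by
      ext z
      simp only [P, Q]
      push_cast
      ring
    have hzero2 : ∀ z : ℝ × ℝ, z ∉ K → φ (2 * z.1) * φ z.2 = 0 := by
      intro z hz
      by_contra hne
      apply hz
      simp only [mul_eq_zero, not_or] at hne
      apply hKm
      · by_contra hh
        exact hne.1 (hφ.eq_zero _ (by rw [abs_mul, abs_two]; linarith))
      · by_contra hh
        exact hne.2 (hφ.eq_zero _ (by linarith))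
    have hPc : Continuous P := Complex.continuous_ofReal.comp (by fun_prop)
    have hQc : Continuous Q := Complex.continuous_ofReal.comp (by fun_prop)
    have hPs : HasCompactSupport P := HasCompactSupport.intro hK (fun z hz => by
      simp only [P]; rw [mul_assoc, hzero2 z hz]; simp)
    have hQs : HasCompactSupport Q := HasCompactSupport.intro hK (fun z hz => by
      simp only [Q]; rw [mul_assoc, sub_mul, hzero2 z hz, hsupp z hz]; simp)
    have eP : NN P ≤ ((C1 + C2 : ℝ≥0) : ℝ≥0∞) * (n + 1 : ℕ) := by
      have := NN_scale (fun z => ((φ (Λ / 2 * z.1 * z.2) * φ z.1 * φ z.2 : ℝ) : ℂ))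
        (a := 2) (b := 1) (by norm_num) (by norm_num)
      have e : P = fun z : ℝ × ℝ => ((φ (Λ / 2 * (2 * z.1) * (1 * z.2)) * φ (2 * z.1)
          * φ (1 * z.2) : ℝ) : ℂ) := by
        ext z
        simp only [P, one_mul]
        congr 5
        ring
      rw [e, this]
      exact ih (Λ / 2) (by positivity) (by rw [pow_succ] at hΛ; linarith)
    have eQ : NN Q ≤ C2 := by
      have := NN_scale (fun z => M2 (Λ⁻¹, z)) (a := 1) (b := Λ) (by norm_num) h0
      have e : Q = fun z : ℝ × ℝ => M2 (Λ⁻¹, (1 * z.1, Λ * z.2)) := by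
        ext z
        simp only [Q, M2, one_mul]
        rw [inv_mul_cancel_left₀ h0.ne',
          show z.1 * (Λ * z.2) = Λ * z.1 * z.2 by ring]
      rw [e, this]
      exact hC2 Λ⁻¹ ⟨by positivity, inv_le_one_of_one_le₀ hΛ1.le⟩
    rw [hsum]
    refine (NN_add hPc hPs hQc hQs).trans ((add_le_add eP eQ).trans ?_)
    have : (C2 : ℝ≥0∞) ≤ ((C1 + C2 : ℝ≥0) : ℝ≥0∞) * 1 := by simp
    refine (add_le_add_right this _).trans ?_
    rw [← mul_add]
    push_cast
    exact le_rfl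

/-- **Multiplier bound** (Lemma 3.5): for `T > 1`, `T/2 ≤ t ≤ T` and
`m̃(η,κ) = φ(t^{1/4}ηκ)φ((10T)^{-1/6}η)φ((10T)^{-1/6}κ)`, one has
`‖F_{η,κ}m̃‖_{L¹(ℝ²)} ≲ t^{δ/100}`, uniformly in `T` and `t`. -/
theorem multiplier_L1_bound (δ : ℝ) (hδ0 : 0 < δ) (hδ : δ < 1 / 1000)
    (φ : ℝ → ℝ) (hφ : IsCutoff φ) :
    ∃ C : ℝ, 0 < C ∧ ∀ T t : ℝ, 1 < T → T / 2 ≤ t → t ≤ T →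
      (∫⁻ w : ℝ × ℝ,
          (‖invFT2 (fun ηκ =>
              ((φ (t ^ ((1 : ℝ) / 4) * ηκ.1 * ηκ.2) *
                φ ((10 * T) ^ (-(1 : ℝ) / 6) * ηκ.1) *
                φ ((10 * T) ^ (-(1 : ℝ) / 6) * ηκ.2) : ℝ) : ℂ)) w‖₊ : ℝ≥0∞)) ≤
        ENNReal.ofReal (C * t ^ (δ / 100)) := by
  obtain ⟨C0, hC0⟩ := main_cutoff φ hφ
  set ε := δ / 100 with hε
  have hε0 : 0 < ε := by positivity
  have hl2 : 0 < Real.log 2 := Real.log_pos (by norm_num)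
  refine ⟨(C0 + 1) * ((2 + 1 / (ε * Real.log 2)) * 20 ^ ε), by positivity, ?_⟩
  intro T t hT hTt htT
  have ht : 0 < t := by linarith
  set r := (10 * T) ^ (-(1 : ℝ) / 6) with hr
  have hr0 : 0 < r := by positivity
  set A := t ^ ((1 : ℝ) / 4) with hA
  have hA0 : 0 < A := by positivity
  set Λ := A / r ^ 2 with hΛ
  have hΛ0 : 0 < Λ := by positivity
  have hr2 : (r ^ 2)⁻¹ = (10 * T) ^ ((1 : ℝ) / 3) := by
    rw [hr, ← Real.rpow_natCast, ← Real.rpow_mul (by positivity), ← Real.rpow_neg (by positivity)]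
    norm_num
  have h20 : 1 ≤ 20 * t := by linarith
  have hΛle : Λ ≤ 20 * t := by
    rw [hΛ, div_eq_mul_inv, hr2, hA]
    calc t ^ ((1 : ℝ) / 4) * (10 * T) ^ ((1 : ℝ) / 3)
        ≤ (20 * t) ^ ((1 : ℝ) / 4) * (20 * t) ^ ((1 : ℝ) / 3) := by
          have h1 : t ≤ 20 * t := by linarith
          have h2 : 10 * T ≤ 20 * t := by linarith
          exact mul_le_mul (Real.rpow_le_rpow ht.le h1 (by norm_num))
            (Real.rpow_le_rpow (by linarith) h2 (by norm_num)) (by positivity) (by positivity)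
      _ = (20 * t) ^ ((7 : ℝ) / 12) := by
          rw [← Real.rpow_add (by positivity)]; norm_num
      _ ≤ (20 * t) ^ (1 : ℝ) := Real.rpow_le_rpow_of_exponent_le h20 (by norm_num)
      _ = 20 * t := Real.rpow_one _
  set n := ⌈Real.logb 2 (20 * t)⌉₊ with hn
  have hlog0 : 0 ≤ Real.logb 2 (20 * t) := Real.logb_nonneg (by norm_num) h20
  have hn1 : Λ ≤ 2 ^ n := by
    refine hΛle.trans ?_
    have := Nat.le_ceil (Real.logb 2 (20 * t))
    rw [Real.logb_le_iff_le_rpow (by norm_num) (by positivity)] at this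
    rwa [Real.rpow_natCast] at this
  have hn2 : ((n + 1 : ℕ) : ℝ) ≤ (2 + 1 / (ε * Real.log 2)) * 20 ^ ε * t ^ ε := by
    have h1 := (Nat.ceil_lt_add_one hlog0).le
    rw [← hn] at h1
    have h2 : Real.log (20 * t) ≤ (20 * t) ^ ε / ε := Real.log_le_rpow_div (by positivity) hε0
    have h3 : 1 ≤ (20 * t) ^ ε := Real.one_le_rpow h20 hε0.le
    have h4 : Real.logb 2 (20 * t) ≤ (20 * t) ^ ε * (1 / (ε * Real.log 2)) := by
      rw [Real.logb, div_le_iff₀ hl2]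
      refine h2.trans (le_of_eq ?_)
      field_simp
    rw [mul_assoc, ← Real.mul_rpow (by norm_num) ht.le]
    push_cast
    nlinarith
  have key := hC0 n Λ hΛ0 hn1
  rw [← NN_scale _ hr0 hr0] at key
  have hfun : (fun ηκ : ℝ × ℝ => ((φ (A * ηκ.1 * ηκ.2) * φ (r * ηκ.1) * φ (r * ηκ.2) : ℝ) : ℂ)) =
      fun z : ℝ × ℝ => ((φ (Λ * (r * z.1) * (r * z.2)) * φ (r * z.1) * φ (r * z.2) : ℝ) : ℂ) := by
    ext z
    have : Λ * (r * z.1) * (r * z.2) = A * z.1 * z.2 := by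
      rw [hΛ]
      field_simp
    rw [this]
  rw [hfun]
  refine key.trans ?_
  have : (C0 : ℝ≥0∞) * ((n + 1 : ℕ) : ℝ≥0∞) = ENNReal.ofReal (C0 * ((n + 1 : ℕ) : ℝ)) := by
    rw [ENNReal.ofReal_mul C0.coe_nonneg, ENNReal.ofReal_coe_nnreal, ENNReal.ofReal_natCast]
  rw [this]
  apply ENNReal.ofReal_le_ofReal
  rw [mul_assoc]
  have hc := C0.coe_nonneg
  refine mul_le_mul (by linarith) hn2 (by positivity) (by positivity)

end
end
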